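/- arXiv:2604.08127 — 7 statements merged into one kernel-verified Lean document; each statement's English description precedes it below -/
import Mathlib

section
/- Let d ≥ 1 be an integer and let 0 < k < d. There exists a constant C > 0, depending only on d and k, such that for every t > 0 and every x ∈ ℝ^d, ∫_{ℝ^d} p_t(y) |y − x|^{−k} dy ≤ C t^{−k/2}, and moreover ∫_{ℝ^d} p_t(y) |y − x|^{−k} dy ≤ C |x|^{−k} whenever x ≠ 0. (Probabilistically, the left-hand side is E|W_t − x|^{−k} for a d-dimensional Brownian motion W started at 0.) -/
open Real MeasureTheory

/-- The Gaussian heat kernel `p_t(x) = (2πt)^{-d/2} exp(-|x|²/(2t))` on `ℝ^d`. -/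
noncomputable def heatKernel (d : ℕ) (t : ℝ) (x : EuclideanSpace ℝ (Fin d)) : ℝ :=
  (2 * Real.pi * t) ^ (-(d : ℝ) / 2) * Real.exp (-‖x‖ ^ 2 / (2 * t))

lemma integrableOn_ball_norm_rpow_neg {d : ℕ} (hd : 1 ≤ d) {k : ℝ} (hkd : k < d) :
    IntegrableOn (fun w : EuclideanSpace ℝ (Fin d) ↦ ‖w‖ ^ (-k)) (Metric.ball 0 1) := by
  have : Nonempty (Fin d) := ⟨⟨0, hd⟩⟩
  have h : Integrable (fun w : EuclideanSpace ℝ (Fin d) ↦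
      (Set.Iio (1 : ℝ)).indicator (fun r : ℝ ↦ r ^ (-k)) ‖w‖) := by
    rw [integrable_fun_norm_addHaar volume (f := (Set.Iio (1 : ℝ)).indicator fun r ↦ r ^ (-k))]
    have h1 : IntegrableOn (fun r : ℝ ↦ r ^ ((d : ℝ) - 1 - k)) (Set.Ioo 0 1) :=
      (intervalIntegral.integrableOn_Ioo_rpow_iff zero_lt_one).2 (by linarith)
    rw [← integrable_indicator_iff measurableSet_Ioo] at h1
    refine h1.integrableOn.congr_fun (s := Set.Ioi 0) (fun r hr ↦ ?_) measurableSet_Ioi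
    have hr' : (0 : ℝ) < r := hr
    by_cases h2 : r < 1
    · simp [Set.indicator, hr', h2, ← Real.rpow_natCast, Nat.cast_sub hd,
        ← Real.rpow_add hr', sub_eq_add_neg]
    · simp [Set.indicator, h2]
  rw [← integrable_indicator_iff measurableSet_ball]
  refine h.congr (.of_forall fun w ↦ ?_)
  simp [Set.indicator]

/-- The Riesz potential of order `d - k` of a bounded integrable nonnegative function converges and
is bounded uniformly. -/
lemma riesz_potential_bound {d : ℕ} (hd : 1 ≤ d) {k : ℝ} (hk0 : 0 < k) (hkd : k < d)
    {f : EuclideanSpace ℝ (Fin d) → ℝ} {M : ℝ} (hf : Integrable f) (hf0 : ∀ z, 0 ≤ f z)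
    (hfM : ∀ z, f z ≤ M) (a : EuclideanSpace ℝ (Fin d)) :
    Integrable (fun z ↦ f z * ‖z - a‖ ^ (-k)) ∧
      ∫ z, f z * ‖z - a‖ ^ (-k) ≤
        M * (∫ w in Metric.ball (0 : EuclideanSpace ℝ (Fin d)) 1, ‖w‖ ^ (-k)) + ∫ z, f z := by
  set g : EuclideanSpace ℝ (Fin d) → ℝ := (Metric.ball 0 1).indicator fun w ↦ ‖w‖ ^ (-k) with hg
  have hgi : Integrable g :=
    (integrable_indicator_iff measurableSet_ball).2 (integrableOn_ball_norm_rpow_neg hd hkd)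
  have hga : Integrable fun z ↦ M * g (z - a) := (hgi.comp_sub_right a).const_mul M
  have hle : ∀ z, f z * ‖z - a‖ ^ (-k) ≤ M * g (z - a) + f z := by
    intro z
    by_cases h : ‖z - a‖ < 1
    · have h1 : g (z - a) = ‖z - a‖ ^ (-k) := by simp [hg, h]
      rw [h1]
      have := mul_le_mul_of_nonneg_right (hfM z) (Real.rpow_nonneg (norm_nonneg (z - a)) (-k))
      linarith [hf0 z]
    · have h1 : g (z - a) = 0 := by simp [hg, h]
      rw [h1]
      have := mul_le_mul_of_nonneg_left
        (Real.rpow_le_one_of_one_le_of_nonpos (not_lt.1 h) (neg_nonpos.2 hk0.le)) (hf0 z)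
      linarith
  have hint : Integrable (fun z ↦ f z * ‖z - a‖ ^ (-k)) := by
    refine (hga.add hf).mono' (hf.aestronglyMeasurable.mul ?_) (.of_forall fun z ↦ ?_)
    · exact (by fun_prop : Measurable fun z : EuclideanSpace ℝ (Fin d) ↦
        ‖z - a‖ ^ (-k)).aestronglyMeasurable
    · rw [Real.norm_of_nonneg (mul_nonneg (hf0 z) (Real.rpow_nonneg (norm_nonneg _) _))]
      exact hle z
  refine ⟨hint, (integral_mono hint (hga.add hf) hle).trans_eq ?_⟩
  simp only [Pi.add_apply]
  rw [integral_add hga hf, integral_const_mul, integral_sub_right_eq_self g a, hg,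
    integral_indicator measurableSet_ball]

lemma heatKernel_nonneg (d : ℕ) {t : ℝ} (ht : 0 ≤ t) (z : EuclideanSpace ℝ (Fin d)) :
    0 ≤ heatKernel d t z := by
  unfold heatKernel
  positivity

lemma integrable_heatKernel_one_mul_norm_rpow {d : ℕ} (hd : 1 ≤ d) {k : ℝ} (hk : 0 ≤ k) :
    Integrable fun z : EuclideanSpace ℝ (Fin d) ↦ heatKernel d 1 z * ‖z‖ ^ k := by
  have : Nonempty (Fin d) := ⟨⟨0, hd⟩⟩
  have h : Integrable (fun z : EuclideanSpace ℝ (Fin d) ↦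
      Real.exp (-(1 / 2) * ‖z‖ ^ 2) * ‖z‖ ^ k) := by
    rw [integrable_fun_norm_addHaar volume (f := fun r ↦ Real.exp (-(1 / 2) * r ^ 2) * r ^ k)]
    have hd' : (1 : ℝ) ≤ d := by exact_mod_cast hd
    refine (integrableOn_rpow_mul_exp_neg_mul_sq (b := 1 / 2) (s := (d : ℝ) - 1 + k)
      (by norm_num) (by linarith)).congr_fun (fun r hr ↦ ?_) measurableSet_Ioi
    have hr' : (0 : ℝ) < r := hr
    simp only [finrank_euclideanSpace, Fintype.card_fin, smul_eq_mul]
    rw [Real.rpow_add hr', ← Real.rpow_natCast r (d - 1), Nat.cast_sub hd, Nat.cast_one]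
    ring
  refine (h.const_mul ((2 * Real.pi * 1) ^ (-(d : ℝ) / 2))).congr (.of_forall fun z ↦ ?_)
  simp only [heatKernel, ← mul_assoc]
  congr 3
  ring_nf

lemma heatKernel_one_mul_norm_rpow_le (d : ℕ) {k : ℝ} (hk : 0 ≤ k)
    (z : EuclideanSpace ℝ (Fin d)) :
    heatKernel d 1 z * ‖z‖ ^ k ≤ (2 * Real.pi * 1) ^ (-(d : ℝ) / 2) * Real.exp (k ^ 2 / 2) := by
  rw [heatKernel, mul_assoc]
  refine mul_le_mul_of_nonneg_left ?_ (by positivity)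
  have h1 : ‖z‖ ^ k ≤ Real.exp (‖z‖ * k) := by
    rw [Real.exp_mul]
    exact Real.rpow_le_rpow (norm_nonneg z) (by linarith [Real.add_one_le_exp ‖z‖]) hk
  refine (mul_le_mul_of_nonneg_left h1 (Real.exp_nonneg _)).trans ?_
  rw [← Real.exp_add, Real.exp_le_exp]
  nlinarith [sq_nonneg (‖z‖ - k)]

/-- Brownian scaling for the Riesz potential of the heat kernel. -/
lemma integral_heatKernel_mul_norm_sub_rpow {d : ℕ} {t : ℝ} (ht : 0 < t) (k : ℝ)
    (x : EuclideanSpace ℝ (Fin d)) :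
    ∫ y, heatKernel d t y * ‖y - x‖ ^ (-k) =
      t ^ (-k / 2) * ∫ z, heatKernel d 1 z * ‖z - (√t)⁻¹ • x‖ ^ (-k) := by
  have hs : 0 < √t := Real.sqrt_pos.2 ht
  have h := Measure.integral_comp_smul volume
    (fun y : EuclideanSpace ℝ (Fin d) ↦ heatKernel d t y * ‖y - x‖ ^ (-k)) √t
  have hpow : √t ^ d = t ^ ((d : ℝ) / 2) := by
    rw [Real.sqrt_eq_rpow, ← Real.rpow_mul_natCast ht.le]
    ring_nf
  have key : ∀ z : EuclideanSpace ℝ (Fin d), heatKernel d t (√t • z) * ‖√t • z - x‖ ^ (-k) =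
      (√t ^ d)⁻¹ * t ^ (-k / 2) * (heatKernel d 1 z * ‖z - (√t)⁻¹ • x‖ ^ (-k)) := by
    intro z
    have h1 : √t • z - x = √t • (z - (√t)⁻¹ • x) := by
      rw [smul_sub, smul_inv_smul₀ hs.ne']
    have h2 : √t ^ (-k) = t ^ (-k / 2) := by
      rw [Real.sqrt_eq_rpow, ← Real.rpow_mul ht.le]
      ring_nf
    have h3 : heatKernel d t (√t • z) = (√t ^ d)⁻¹ * heatKernel d 1 z := by
      have h4 : -(√t * ‖z‖) ^ 2 / (2 * t) = -‖z‖ ^ 2 / (2 * 1) := by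
        rw [mul_pow, Real.sq_sqrt ht.le]
        field_simp
      rw [heatKernel, heatKernel, norm_smul, Real.norm_of_nonneg hs.le, h4, hpow,
        Real.mul_rpow (by positivity) ht.le, ← Real.rpow_neg ht.le, mul_one, neg_div]
      ring_nf
    rw [h1, norm_smul, Real.norm_of_nonneg hs.le, Real.mul_rpow hs.le (norm_nonneg _), h2, h3]
    ring
  simp only [key, integral_const_mul, finrank_euclideanSpace, Fintype.card_fin, smul_eq_mul] at h
  have hsd : 0 < √t ^ d := by positivity
  rw [abs_of_pos (inv_pos.2 hsd), mul_assoc] at h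
  exact (mul_left_cancel₀ (inv_pos.2 hsd).ne' h).symm

lemma norm_rpow_mul_norm_sub_rpow_neg_le {E : Type*} [NormedAddCommGroup E] {k : ℝ} (hk : 0 < k)
    (a z : E) :
    ‖a‖ ^ k * ‖z - a‖ ^ (-k) ≤ 2 ^ k * (‖z‖ ^ k * ‖z - a‖ ^ (-k) + 1) := by
  rcases eq_or_ne z a with rfl | h
  · rw [sub_self, norm_zero, Real.zero_rpow (neg_ne_zero.2 hk.ne')]
    simp only [mul_zero, zero_add, mul_one]
    positivity
  have hpos : 0 < ‖z - a‖ := norm_sub_pos_iff.2 h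
  have h1 : ‖a‖ ≤ 2 * max ‖z‖ ‖z - a‖ := by
    have : ‖a‖ ≤ ‖z‖ + ‖z - a‖ := by simpa using norm_sub_le z (z - a)
    linarith [le_max_left ‖z‖ ‖z - a‖, le_max_right ‖z‖ ‖z - a‖]
  have h2 : max ‖z‖ ‖z - a‖ ^ k ≤ ‖z‖ ^ k + ‖z - a‖ ^ k := by
    have := Real.rpow_nonneg (norm_nonneg z) k
    have := Real.rpow_nonneg (norm_nonneg (z - a)) k
    rcases max_choice ‖z‖ ‖z - a‖ with h | h <;> rw [h] <;> linarith
  have h3 : ‖a‖ ^ k ≤ 2 ^ k * (‖z‖ ^ k + ‖z - a‖ ^ k) := by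
    refine (Real.rpow_le_rpow (norm_nonneg a) h1 hk.le).trans ?_
    rw [Real.mul_rpow zero_le_two (by positivity)]
    gcongr
  refine (mul_le_mul_of_nonneg_right h3 (Real.rpow_nonneg hpos.le (-k))).trans_eq ?_
  rw [mul_assoc, add_mul, ← Real.rpow_add hpos, add_neg_cancel, Real.rpow_zero]

lemma riesz_potential_heatKernel_one_bound {d : ℕ} (hd : 1 ≤ d) {k : ℝ} (hk0 : 0 < k)
    (hkd : k < d) :
    ∃ C : ℝ, 0 < C ∧ ∀ a : EuclideanSpace ℝ (Fin d),
      (∫ z, heatKernel d 1 z * ‖z - a‖ ^ (-k)) ≤ C ∧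
      ‖a‖ ^ k * (∫ z, heatKernel d 1 z * ‖z - a‖ ^ (-k)) ≤ C := by
  have hp0 := heatKernel_nonneg d zero_le_one
  have hp : Integrable (heatKernel d 1) := by
    simpa using integrable_heatKernel_one_mul_norm_rpow hd le_rfl
  have hq := integrable_heatKernel_one_mul_norm_rpow hd hk0.le
  have hq0 : ∀ z : EuclideanSpace ℝ (Fin d), 0 ≤ heatKernel d 1 z * ‖z‖ ^ k := fun z ↦
    mul_nonneg (hp0 z) (Real.rpow_nonneg (norm_nonneg z) k)
  have hpb := riesz_potential_bound hd hk0 hkd hp hp0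
    fun z ↦ by simpa using heatKernel_one_mul_norm_rpow_le d le_rfl z
  have hqb := riesz_potential_bound hd hk0 hkd hq hq0
    (heatKernel_one_mul_norm_rpow_le d hk0.le)
  obtain ⟨A, hA⟩ : ∃ A, ∀ a : EuclideanSpace ℝ (Fin d),
      ∫ z, heatKernel d 1 z * ‖z - a‖ ^ (-k) ≤ A := ⟨_, fun a ↦ (hpb a).2⟩
  obtain ⟨B, hB⟩ : ∃ B, ∀ a : EuclideanSpace ℝ (Fin d),
      ∫ z, heatKernel d 1 z * ‖z‖ ^ k * ‖z - a‖ ^ (-k) ≤ B := ⟨_, fun a ↦ (hqb a).2⟩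
  refine ⟨max 1 (max A (2 ^ k * (B + ∫ z, heatKernel d 1 z))), by positivity, fun a ↦
    ⟨(hA a).trans (by simp), le_trans ?_ ((le_max_right _ _).trans (le_max_right _ _))⟩⟩
  rw [← integral_const_mul]
  refine (integral_mono ((hpb a).1.const_mul _) (((hqb a).1.add hp).const_mul (2 ^ k))
    fun z ↦ ?_).trans ?_
  · have := mul_le_mul_of_nonneg_left (norm_rpow_mul_norm_sub_rpow_neg_le hk0 a z) (hp0 z)
    simp only [Pi.add_apply]
    linarith
  · simp only [Pi.add_apply]
    rw [integral_const_mul, integral_add (hqb a).1 hp]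
    gcongr
    exact hB a

theorem riesz_potential_heatKernel_bound (d : ℕ) (hd : 1 ≤ d) (k : ℝ)
    (hk0 : 0 < k) (hkd : k < d) :
    ∃ C : ℝ, 0 < C ∧ ∀ t : ℝ, 0 < t → ∀ x : EuclideanSpace ℝ (Fin d),
      (∫ y, heatKernel d t y * ‖y - x‖ ^ (-k)) ≤ C * t ^ (-k / 2) ∧
      (x ≠ 0 → (∫ y, heatKernel d t y * ‖y - x‖ ^ (-k)) ≤ C * ‖x‖ ^ (-k)) := by
  obtain ⟨C, hC, h⟩ := riesz_potential_heatKernel_one_bound hd hk0 hkd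
  refine ⟨C, hC, fun t ht x ↦ ?_⟩
  obtain ⟨h1, h2⟩ := h ((√t)⁻¹ • x)
  rw [integral_heatKernel_mul_norm_sub_rpow ht]
  refine ⟨by rw [mul_comm]; gcongr, fun hx ↦ ?_⟩
  have hx' : 0 < ‖x‖ := norm_pos_iff.2 hx
  have hs : ‖(√t)⁻¹ • x‖ ^ k = t ^ (-k / 2) * ‖x‖ ^ k := by
    rw [norm_smul, Real.norm_of_nonneg (by positivity), Real.mul_rpow (by positivity) hx'.le,
      Real.sqrt_eq_rpow, ← Real.rpow_neg ht.le, ← Real.rpow_mul ht.le]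
    ring_nf
  rw [hs] at h2
  rw [Real.rpow_neg hx'.le, ← div_eq_mul_inv, le_div_iff₀ (by positivity)]
  linarith
end

section
/- Let d ≥ 1 be an integer and let 0 < k < d. There exists a constant C > 0, depending only on d and k (in particular not on θ), such that for every θ with 0 ≤ θ ≤ k/2, every t > 0, every x ∈ ℝ^d with x ≠ 0, and every y ∈ ℝ^d with y ≠ x, ∫_{ℝ^d} p_t(z) |z − x|^{−k} |z − y|^{−θ} dz ≤ C t^{−(k−θ)/2} |x|^{−θ} |x − y|^{−θ}. (Probabilistically, the left-hand side is E[|W_t − x|^{−k} |W_t − y|^{−θ}] for a d-dimensional Brownian motion W started at 0.) -/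
open Real MeasureTheory

lemma Real.add_rpow_le_two_rpow_mul {a b p : ℝ} (ha : 0 ≤ a) (hb : 0 ≤ b) (hp : 0 ≤ p) :
    (a + b) ^ p ≤ 2 ^ p * (a ^ p + b ^ p) := by
  have hmax : max a b ^ p ≤ a ^ p + b ^ p := by
    have := rpow_nonneg ha p
    have := rpow_nonneg hb p
    rcases max_choice a b with h | h <;> rw [h] <;> linarith
  calc (a + b) ^ p ≤ (2 * max a b) ^ p := by
        gcongr
        linarith [le_max_left a b, le_max_right a b]
    _ = 2 ^ p * max a b ^ p := mul_rpow zero_le_two (ha.trans (le_max_left a b))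
    _ ≤ _ := by gcongr

lemma Real.rpow_neg_mul_rpow_neg_le {u v p q k : ℝ} (hu : 0 < u) (hv : 0 < v) (hp : 0 ≤ p)
    (hq : 0 ≤ q) (hpq : p + q ≤ k) :
    u ^ (-p) * v ^ (-q) ≤ 1 + u ^ (-k) + v ^ (-k) := by
  set m := min (min u v) 1 with hm
  have hm0 : 0 < m := by positivity
  have hmu : m ≤ u := (min_le_left _ _).trans (min_le_left _ _)
  have hmv : m ≤ v := (min_le_left _ _).trans (min_le_right _ _)
  have hu' := rpow_nonneg hu.le (-k)
  have hv' := rpow_nonneg hv.le (-k)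
  calc u ^ (-p) * v ^ (-q) ≤ m ^ (-p) * m ^ (-q) := by
        gcongr ?_ * ?_
        · exact rpow_le_rpow_of_nonpos hm0 hmu (by linarith)
        · exact rpow_le_rpow_of_nonpos hm0 hmv (by linarith)
    _ = m ^ (-p + -q) := (rpow_add hm0 _ _).symm
    _ ≤ m ^ (-k) := rpow_le_rpow_of_exponent_ge hm0 (min_le_right _ _) (by linarith)
    _ ≤ _ := by
        rcases min_choice (min u v) 1 with h | h
        · rcases min_choice u v with h' | h' <;> rw [hm, h, h'] <;> linarith
        · rw [hm, h, one_rpow]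
          linarith

lemma Real.rpow_mul_exp_neg_sq_div_two_le {w k : ℝ} (hw : 0 ≤ w) (hk : 0 < k) :
    w ^ k * exp (-w ^ 2 / 2) ≤ (2 * k) ^ (k / 2) * exp (-w ^ 2 / 4) := by
  have hpow : w ^ k ≤ (2 * k) ^ (k / 2) * exp (w ^ 2 / 4) := by
    calc w ^ k = (w ^ 2) ^ (k / 2) := by
          rw [← rpow_natCast, ← rpow_mul hw]
          congr 1
          push_cast
          ring
      _ = (2 * k * (w ^ 2 / (2 * k))) ^ (k / 2) := by
          congr 1
          field_simp
      _ = (2 * k) ^ (k / 2) * (w ^ 2 / (2 * k)) ^ (k / 2) :=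
          mul_rpow (by positivity) (by positivity)
      _ ≤ (2 * k) ^ (k / 2) * exp (w ^ 2 / (2 * k)) ^ (k / 2) := by
          gcongr
          linarith [add_one_le_exp (w ^ 2 / (2 * k))]
      _ = (2 * k) ^ (k / 2) * exp (w ^ 2 / 4) := by
          rw [← exp_mul]
          congr 2
          field_simp
          norm_num
  calc w ^ k * exp (-w ^ 2 / 2) ≤ (2 * k) ^ (k / 2) * exp (w ^ 2 / 4) * exp (-w ^ 2 / 2) := by
        gcongr
    _ = (2 * k) ^ (k / 2) * exp (-w ^ 2 / 4) := by
        rw [mul_assoc, ← exp_add]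
        congr 2
        ring

lemma rpow_mul_rpow_mul_riesz_le {A B u v w k θ : ℝ} (hA : 0 ≤ A) (hB : 0 ≤ B) (hu : 0 < u)
    (hv : 0 < v) (hw : 0 ≤ w) (hAuw : A ≤ u + w) (hBuv : B ≤ u + v) (hθ : 0 ≤ θ)
    (hθk : θ ≤ k / 2) :
    A ^ θ * B ^ θ * (u ^ (-k) * v ^ (-θ)) ≤
      4 ^ k * ((4 + 2 * w ^ k) * (1 + u ^ (-k) + v ^ (-k))) := by
  have hS : 0 ≤ 1 + u ^ (-k) + v ^ (-k) := by positivity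
  have hA' : A ^ θ ≤ 2 ^ k * (u ^ θ + w ^ θ) := calc
    A ^ θ ≤ (u + w) ^ θ := by gcongr
    _ ≤ 2 ^ θ * (u ^ θ + w ^ θ) := add_rpow_le_two_rpow_mul hu.le hw hθ
    _ ≤ _ := by gcongr <;> linarith
  have hB' : B ^ θ ≤ 2 ^ k * (u ^ θ + v ^ θ) := calc
    B ^ θ ≤ (u + v) ^ θ := by gcongr
    _ ≤ 2 ^ θ * (u ^ θ + v ^ θ) := add_rpow_le_two_rpow_mul hu.le hv.le hθ
    _ ≤ _ := by gcongr <;> linarith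
  have hwθ : w ^ θ ≤ 1 + w ^ k := by
    rcases le_total w 1 with h | h
    · linarith [rpow_le_one hw h hθ, rpow_nonneg hw k]
    · linarith [rpow_le_rpow_of_exponent_le h (show θ ≤ k by linarith)]
  have h₁ := rpow_neg_mul_rpow_neg_le hu hv (p := k - 2 * θ) (q := θ) (k := k) (by linarith) hθ
    (by linarith)
  have h₂ := rpow_neg_mul_rpow_neg_le hu hv (p := k - θ) (q := 0) (k := k) (by linarith) le_rfl
    (by linarith)
  have h₃ := rpow_neg_mul_rpow_neg_le hu hv (p := k - θ) (q := θ) (k := k) (by linarith) hθ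
    (by linarith)
  have h₄ := rpow_neg_mul_rpow_neg_le hu hv (p := k) (q := 0) (k := k) (by linarith) le_rfl
    (by linarith)
  rw [neg_zero, rpow_zero, mul_one] at h₂ h₄
  have e₁ : u ^ θ * u ^ (-k) = u ^ (-(k - θ)) := by
    rw [← rpow_add hu]
    ring_nf
  have e₂ : u ^ θ * u ^ (-(k - θ)) = u ^ (-(k - 2 * θ)) := by
    rw [← rpow_add hu]
    ring_nf
  have e₃ : v ^ θ * v ^ (-θ) = 1 := by
    rw [← rpow_add hv, add_neg_cancel, rpow_zero]
  calc A ^ θ * B ^ θ * (u ^ (-k) * v ^ (-θ))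
      ≤ (2 ^ k * (u ^ θ + w ^ θ)) * (2 ^ k * (u ^ θ + v ^ θ)) * (u ^ (-k) * v ^ (-θ)) := by
        gcongr
    _ = 4 ^ k * (u ^ (-(k - 2 * θ)) * v ^ (-θ) + u ^ (-(k - θ)) +
          w ^ θ * (u ^ (-(k - θ)) * v ^ (-θ) + u ^ (-k))) := by
        rw [← e₂, ← e₁, show (4 : ℝ) = 2 * 2 by norm_num, mul_rpow zero_le_two zero_le_two]
        linear_combination 2 ^ k * 2 ^ k * (u ^ θ + w ^ θ) * u ^ (-k) * e₃
    _ ≤ 4 ^ k * (2 * (1 + u ^ (-k) + v ^ (-k)) +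
          (1 + w ^ k) * (2 * (1 + u ^ (-k) + v ^ (-k)))) := by
        gcongr ?_ * (?_ + ?_)
        · linarith
        · gcongr
          linarith
    _ = _ := by ring

section RieszKernel

variable {E : Type*} [NormedAddCommGroup E]

/-- The Riesz kernel `‖z‖ ^ (-k)` truncated to the unit ball. -/
noncomputable def truncatedRiesz (k : ℝ) (z : E) : ℝ :=
  (Metric.ball (0 : E) 1).indicator (fun z ↦ ‖z‖ ^ (-k)) z

lemma truncatedRiesz_nonneg (k : ℝ) (z : E) : 0 ≤ truncatedRiesz k z :=
  Set.indicator_nonneg (fun _ _ ↦ by positivity) z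

lemma norm_rpow_neg_le_one_add_truncatedRiesz {k : ℝ} (hk : 0 ≤ k) (z : E) :
    ‖z‖ ^ (-k) ≤ 1 + truncatedRiesz k z := by
  by_cases hz : z ∈ Metric.ball (0 : E) 1
  · rw [truncatedRiesz, Set.indicator_of_mem hz]
    linarith
  · rw [truncatedRiesz, Set.indicator_of_notMem hz, add_zero]
    exact rpow_le_one_of_one_le_of_nonpos (by simpa using hz) (by linarith)

lemma exp_neg_sq_norm_mul_riesz_le {k θ : ℝ} (hk : 0 < k) (hθ : 0 ≤ θ) (hθk : θ ≤ k / 2)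
    {x y z : E} (hx : x ≠ 0) (hyx : y ≠ x) (hzx : z ≠ x) (hzy : z ≠ y) :
    exp (-‖z‖ ^ 2 / 2) * ‖z - x‖ ^ (-k) * ‖z - y‖ ^ (-θ) ≤
      4 ^ k * (4 + 2 * (2 * k) ^ (k / 2)) * ‖x‖ ^ (-θ) * ‖x - y‖ ^ (-θ) *
        (3 * exp (-‖z‖ ^ 2 / 4) + truncatedRiesz k (z - x) + truncatedRiesz k (z - y)) := by
  have hA : 0 < ‖x‖ := norm_pos_iff.2 hx
  have hB : 0 < ‖x - y‖ := norm_pos_iff.2 (sub_ne_zero.2 hyx.symm)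
  have hu : 0 < ‖z - x‖ := norm_pos_iff.2 (sub_ne_zero.2 hzx)
  have hv : 0 < ‖z - y‖ := norm_pos_iff.2 (sub_ne_zero.2 hzy)
  have hpt := rpow_mul_rpow_mul_riesz_le hA.le hB.le hu hv (norm_nonneg z)
    (by rw [norm_sub_rev]; exact norm_le_norm_sub_add x z)
    (by rw [norm_sub_rev z x]; exact norm_sub_le_norm_sub_add_norm_sub x z y) hθ hθk
  set K : ℝ := 4 + 2 * (2 * k) ^ (k / 2) with hK
  have hgauss : exp (-‖z‖ ^ 2 / 2) * (4 + 2 * ‖z‖ ^ k) ≤ K * exp (-‖z‖ ^ 2 / 4) := by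
    have h₁ := rpow_mul_exp_neg_sq_div_two_le (norm_nonneg z) hk
    have h₂ : exp (-‖z‖ ^ 2 / 2) ≤ exp (-‖z‖ ^ 2 / 4) :=
      exp_le_exp.2 (by nlinarith [sq_nonneg ‖z‖])
    rw [hK]
    linarith
  have hriesz : exp (-‖z‖ ^ 2 / 4) * (1 + ‖z - x‖ ^ (-k) + ‖z - y‖ ^ (-k)) ≤
      3 * exp (-‖z‖ ^ 2 / 4) + truncatedRiesz k (z - x) + truncatedRiesz k (z - y) := by
    have h₁ := norm_rpow_neg_le_one_add_truncatedRiesz hk.le (z - x)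
    have h₂ := norm_rpow_neg_le_one_add_truncatedRiesz hk.le (z - y)
    have h₃ : exp (-‖z‖ ^ 2 / 4) ≤ 1 := exp_le_one_iff.2 (by nlinarith [sq_nonneg ‖z‖])
    have h₄ := truncatedRiesz_nonneg k (z - x)
    have h₅ := truncatedRiesz_nonneg k (z - y)
    calc _ ≤ exp (-‖z‖ ^ 2 / 4) * (3 + (truncatedRiesz k (z - x) + truncatedRiesz k (z - y))) := by
          exact mul_le_mul_of_nonneg_left (by linarith) (exp_nonneg _)
      _ ≤ _ := by nlinarith [mul_le_mul_of_nonneg_right h₃ (add_nonneg h₄ h₅)]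
  have hcancel : ∀ r : ℝ, 0 < r → r ^ (-θ) * r ^ θ = 1 := fun r hr ↦ by
    rw [← rpow_add hr, neg_add_cancel, rpow_zero]
  calc exp (-‖z‖ ^ 2 / 2) * ‖z - x‖ ^ (-k) * ‖z - y‖ ^ (-θ)
      = ‖x‖ ^ (-θ) * ‖x - y‖ ^ (-θ) * (exp (-‖z‖ ^ 2 / 2) *
          (‖x‖ ^ θ * ‖x - y‖ ^ θ * (‖z - x‖ ^ (-k) * ‖z - y‖ ^ (-θ)))) := by
        linear_combination (-(exp (-‖z‖ ^ 2 / 2) * ‖z - x‖ ^ (-k) * ‖z - y‖ ^ (-θ))) *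
          (hcancel _ hA * (‖x - y‖ ^ (-θ) * ‖x - y‖ ^ θ) + hcancel _ hB)
    _ ≤ ‖x‖ ^ (-θ) * ‖x - y‖ ^ (-θ) * (exp (-‖z‖ ^ 2 / 2) *
          (4 ^ k * ((4 + 2 * ‖z‖ ^ k) * (1 + ‖z - x‖ ^ (-k) + ‖z - y‖ ^ (-k))))) := by
        gcongr
    _ = 4 ^ k * ‖x‖ ^ (-θ) * ‖x - y‖ ^ (-θ) * (exp (-‖z‖ ^ 2 / 2) * (4 + 2 * ‖z‖ ^ k) *
          (1 + ‖z - x‖ ^ (-k) + ‖z - y‖ ^ (-k))) := by ring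
    _ ≤ 4 ^ k * ‖x‖ ^ (-θ) * ‖x - y‖ ^ (-θ) * (K * exp (-‖z‖ ^ 2 / 4) *
          (1 + ‖z - x‖ ^ (-k) + ‖z - y‖ ^ (-k))) := by gcongr
    _ = 4 ^ k * K * ‖x‖ ^ (-θ) * ‖x - y‖ ^ (-θ) * (exp (-‖z‖ ^ 2 / 4) *
          (1 + ‖z - x‖ ^ (-k) + ‖z - y‖ ^ (-k))) := by ring
    _ ≤ _ := by gcongr

variable [InnerProductSpace ℝ E] [FiniteDimensional ℝ E] [MeasurableSpace E] [BorelSpace E]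

lemma integrable_exp_neg_sq_norm_div_four :
    Integrable fun z : E ↦ exp (-‖z‖ ^ 2 / 4) := by
  refine Integrable.of_integral_ne_zero ?_
  have h := GaussianFourier.integral_rexp_neg_mul_sq_norm (V := E) (b := 1 / 4) (by norm_num)
  simp_rw [show ∀ z : E, -‖z‖ ^ 2 / 4 = -(1 / 4) * ‖z‖ ^ 2 from fun z ↦ by ring, h]
  positivity

lemma integrable_truncatedRiesz [Nontrivial E] {k : ℝ} (hk : k < Module.finrank ℝ E) :
    Integrable (truncatedRiesz k : E → ℝ) := by
  refine (integrable_indicator_iff measurableSet_ball).2 ?_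
  refine integrableOn_ball_of_norm_le_rpow (C := 1) Module.finrank_pos hk ?_ ?_
  · refine .of_forall fun z ↦ ?_
    rw [one_mul, norm_of_nonneg (by positivity)]
  · exact (measurable_norm.pow_const _).aestronglyMeasurable

lemma exists_integral_exp_neg_sq_norm_mul_riesz_le [Nontrivial E] {k : ℝ} (hk : 0 < k)
    (hkd : k < Module.finrank ℝ E) :
    ∃ C : ℝ, 0 < C ∧ ∀ θ : ℝ, 0 ≤ θ → θ ≤ k / 2 → ∀ x y : E, x ≠ 0 → y ≠ x →
      (∫ z : E, exp (-‖z‖ ^ 2 / 2) * ‖z - x‖ ^ (-k) * ‖z - y‖ ^ (-θ)) ≤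
        C * ‖x‖ ^ (-θ) * ‖x - y‖ ^ (-θ) := by
  have hG := integrable_exp_neg_sq_norm_div_four (E := E)
  have hR := integrable_truncatedRiesz hkd
  have hGpos : 0 < ∫ z : E, exp (-‖z‖ ^ 2 / 4) := integral_exp_pos hG
  have hRnonneg : 0 ≤ ∫ z : E, truncatedRiesz k z := integral_nonneg (truncatedRiesz_nonneg k)
  refine ⟨4 ^ k * (4 + 2 * (2 * k) ^ (k / 2)) *
    (3 * (∫ z : E, exp (-‖z‖ ^ 2 / 4)) + 2 * ∫ z : E, truncatedRiesz k z), by positivity, ?_⟩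
  intro θ hθ hθk x y hx hyx
  have hRx := hR.comp_sub_right x
  have hRy := hR.comp_sub_right y
  have hint := ((hG.const_mul 3).add hRx).add hRy
  refine (integral_mono_of_nonneg (.of_forall fun z ↦ by positivity)
    (hint.const_mul (4 ^ k * (4 + 2 * (2 * k) ^ (k / 2)) * ‖x‖ ^ (-θ) * ‖x - y‖ ^ (-θ)))
    ?_).trans_eq ?_
  · filter_upwards [Measure.ae_ne volume x, Measure.ae_ne volume y] with z hzx hzy
    exact exp_neg_sq_norm_mul_riesz_le hk hθ hθk hx hyx hzx hzy
  · rw [integral_const_mul, integral_add' ((hG.const_mul 3).add hRx) hRy,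
      integral_add' (hG.const_mul 3) hRx, integral_const_mul,
      integral_sub_right_eq_self (truncatedRiesz k) x,
      integral_sub_right_eq_self (truncatedRiesz k) y]
    ring

end RieszKernel

lemma heatKernel_sq_smul (d : ℕ) {s : ℝ} (hs : 0 < s) (z : EuclideanSpace ℝ (Fin d)) :
    heatKernel d (s ^ 2) (s • z) =
      (2 * π) ^ (-(d : ℝ) / 2) * (s ^ d)⁻¹ * exp (-‖z‖ ^ 2 / 2) := by
  have hpow : (s ^ 2) ^ (-(d : ℝ) / 2) = (s ^ d)⁻¹ := by
    rw [← rpow_natCast s 2, ← rpow_mul hs.le, ← rpow_natCast s d, ← rpow_neg hs.le]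
    congr 1
    push_cast
    ring
  rw [heatKernel, mul_rpow (by positivity) (by positivity), hpow, norm_smul, norm_of_nonneg hs.le]
  congr 2
  field_simp

lemma integral_heatKernel_mul_riesz_smul (d : ℕ) {s : ℝ} (hs : 0 < s) (k θ : ℝ)
    (x y : EuclideanSpace ℝ (Fin d)) :
    (∫ z, heatKernel d (s ^ 2) z * ‖z - s • x‖ ^ (-k) * ‖z - s • y‖ ^ (-θ)) =
      (2 * π) ^ (-(d : ℝ) / 2) * s ^ (-k) * s ^ (-θ) *
        ∫ z : EuclideanSpace ℝ (Fin d),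
          exp (-‖z‖ ^ 2 / 2) * ‖z - x‖ ^ (-k) * ‖z - y‖ ^ (-θ) := by
  have hsub : ∀ (z a : EuclideanSpace ℝ (Fin d)) (p : ℝ),
      ‖s • z - s • a‖ ^ p = s ^ p * ‖z - a‖ ^ p := fun z a p ↦ by
    rw [← smul_sub, norm_smul, norm_of_nonneg hs.le, mul_rpow hs.le (norm_nonneg _)]
  have h := Measure.integral_comp_smul_of_nonneg volume
    (fun z ↦ heatKernel d (s ^ 2) z * ‖z - s • x‖ ^ (-k) * ‖z - s • y‖ ^ (-θ)) s (hR := hs.le)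
  rw [finrank_euclideanSpace_fin, smul_eq_mul, eq_inv_mul_iff_mul_eq₀ (by positivity)] at h
  rw [← h, ← integral_const_mul, ← integral_const_mul]
  congr 1 with z
  rw [heatKernel_sq_smul d hs, hsub, hsub]
  field_simp

theorem mixed_riesz_heatKernel_bound (d : ℕ) (hd : 1 ≤ d) (k : ℝ)
    (hk0 : 0 < k) (hkd : k < d) :
    ∃ C : ℝ, 0 < C ∧ ∀ θ : ℝ, 0 ≤ θ → θ ≤ k / 2 → ∀ t : ℝ, 0 < t →
      ∀ x y : EuclideanSpace ℝ (Fin d), x ≠ 0 → y ≠ x →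
        (∫ z, heatKernel d t z * ‖z - x‖ ^ (-k) * ‖z - y‖ ^ (-θ)) ≤
          C * t ^ (-(k - θ) / 2) * ‖x‖ ^ (-θ) * ‖x - y‖ ^ (-θ) := by
  have : Nonempty (Fin d) := ⟨⟨0, hd⟩⟩
  obtain ⟨C, hC, hbound⟩ := exists_integral_exp_neg_sq_norm_mul_riesz_le
    (E := EuclideanSpace ℝ (Fin d)) hk0 (by rwa [finrank_euclideanSpace_fin])
  refine ⟨(2 * π) ^ (-(d : ℝ) / 2) * C, by positivity, ?_⟩
  intro θ hθ hθk t ht x y hx hyx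
  obtain ⟨s, hs, rfl⟩ : ∃ s : ℝ, 0 < s ∧ s ^ 2 = t := ⟨√t, sqrt_pos.2 ht, sq_sqrt ht.le⟩
  obtain ⟨x, rfl⟩ : ∃ x', s • x' = x := ⟨s⁻¹ • x, smul_inv_smul₀ hs.ne' x⟩
  obtain ⟨y, rfl⟩ : ∃ y', s • y' = y := ⟨s⁻¹ • y, smul_inv_smul₀ hs.ne' y⟩
  have hx' : x ≠ 0 := by
    rintro rfl
    simp at hx
  have hyx' : y ≠ x := by
    rintro rfl
    simp at hyx
  have hpow : (s ^ 2) ^ (-(k - θ) / 2) * s ^ (-θ) = s ^ (-k) := by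
    rw [← rpow_natCast s 2, ← rpow_mul hs.le, ← rpow_add hs]
    congr 1
    push_cast
    ring
  rw [integral_heatKernel_mul_riesz_smul d hs, ← smul_sub, norm_smul, norm_smul,
    norm_of_nonneg hs.le, mul_rpow hs.le (norm_nonneg _), mul_rpow hs.le (norm_nonneg _)]
  calc _ ≤ (2 * π) ^ (-(d : ℝ) / 2) * s ^ (-k) * s ^ (-θ) *
        (C * ‖x‖ ^ (-θ) * ‖x - y‖ ^ (-θ)) := by
        gcongr
        exact hbound θ hθ hθk x y hx' hyx'
    _ = _ := by
        rw [← hpow]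
        ring
end

section
/- (Dirichlet integral.) Let m ≥ 1 be an integer, let α₁, …, α_m > 0 and let t > 0. Then, with s₀ := 0, ∫_{0 < s₁ < s₂ < … < s_m < t} ∏_{i=1}^m (s_i − s_{i−1})^{α_i − 1} ds₁ … ds_m = (Γ(α₁) Γ(α₂) ⋯ Γ(α_m) / Γ(α₁ + α₂ + … + α_m + 1)) · t^{α₁ + α₂ + … + α_m}, where Γ is the Gamma function and the integral is with respect to Lebesgue measure on the ordered simplex {(s₁,…,s_m) : 0 < s₁ < … < s_m < t} ⊆ ℝ^m. -/
open Real MeasureTheory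

/-- The value preceding `s i` in a finite sequence, with the convention `s₀ = 0`. -/
def fprev {m : ℕ} {E : Type*} [Zero E] (s : Fin m → E) (i : Fin m) : E :=
  if (i : ℕ) = 0 then 0
  else s ⟨(i : ℕ) - 1, lt_of_le_of_lt (Nat.sub_le _ _) i.isLt⟩

lemma lintegral_Ioo_rpow_mul_sub_rpow {a b t : ℝ} (ha : 0 < a) (hb : 0 < b) (ht : 0 < t) :
    ∫⁻ x, (Set.Ioo 0 t).indicator
        (fun x ↦ ENNReal.ofReal (x ^ (a - 1) * (t - x) ^ (b - 1))) x =
      ENNReal.ofReal (t ^ (a + b - 1) * ProbabilityTheory.beta a b) := by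
  have hB := ProbabilityTheory.beta_pos ha hb
  have hmeas : Measurable ((Set.Ioo 0 t).indicator
      (fun x ↦ ENNReal.ofReal (x ^ (a - 1) * (t - x) ^ (b - 1)))) :=
    Measurable.indicator (by fun_prop) measurableSet_Ioo
  have hpt (y : ℝ) : (Set.Ioo 0 t).indicator
      (fun x ↦ ENNReal.ofReal (x ^ (a - 1) * (t - x) ^ (b - 1))) (t * y) =
      ENNReal.ofReal (t ^ (a + b - 2) * ProbabilityTheory.beta a b) *
        ProbabilityTheory.betaPDF a b y := by
    by_cases hy : 0 < y ∧ y < 1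
    · have hmem : t * y ∈ Set.Ioo 0 t :=
        ⟨mul_pos ht hy.1, mul_lt_of_lt_one_right ht hy.2⟩
      rw [Set.indicator_of_mem hmem, ProbabilityTheory.betaPDF_of_pos_lt_one hy.1 hy.2,
        ← ENNReal.ofReal_mul (by positivity)]
      congr 1
      rw [show t - t * y = t * (1 - y) by ring, mul_rpow ht.le hy.1.le,
        mul_rpow ht.le (by linarith [hy.2]), show a + b - 2 = (a - 1) + (b - 1) by ring,
        rpow_add ht]
      field_simp
    · have hmem : t * y ∉ Set.Ioo 0 t := fun h ↦
        hy ⟨pos_of_mul_pos_right h.1 ht.le, by nlinarith [h.2]⟩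
      rw [Set.indicator_of_notMem hmem, ProbabilityTheory.betaPDF_eq, if_neg hy]
      simp
  conv_lhs => rw [← Real.smul_map_volume_mul_left ht.ne']
  rw [lintegral_smul_measure, lintegral_map hmeas (by fun_prop)]
  simp_rw [hpt]
  rw [lintegral_const_mul' _ _ ENNReal.ofReal_ne_top,
    ProbabilityTheory.lintegral_betaPDF_eq_one ha hb, mul_one, smul_eq_mul, abs_of_pos ht,
    ← ENNReal.ofReal_mul ht.le]
  congr 1
  rw [show a + b - 1 = 1 + (a + b - 2) by ring, rpow_add ht, rpow_one, mul_assoc]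

lemma fprev_cons_zero {n : ℕ} (x : ℝ) (y : Fin n → ℝ) :
    fprev (Fin.cons x y : Fin (n + 1) → ℝ) 0 = 0 := by
  simp [fprev]

lemma fprev_cons_add_succ {n : ℕ} (x : ℝ) (y : Fin n → ℝ) (i : Fin n) :
    fprev (Fin.cons x (y + fun _ ↦ x) : Fin (n + 1) → ℝ) i.succ = fprev y i + x := by
  rcases n with _ | n
  · exact i.elim0
  · induction i using Fin.cases with
    | zero => simp [fprev]
    | succ j => simp [fprev]; rfl

@[fun_prop]
lemma measurable_fprev {m : ℕ} (i : Fin m) : Measurable fun s : Fin m → ℝ ↦ fprev s i := by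
  unfold fprev
  split_ifs <;> fun_prop

/-- The ordered simplex `{0 < s₁ < … < s_m < t}`. -/
def orderedSimplex (m : ℕ) (t : ℝ) : Set (Fin m → ℝ) :=
  {s | (∀ i, fprev s i < s i) ∧ ∀ i, s i < t}

lemma measurableSet_orderedSimplex (m : ℕ) (t : ℝ) : MeasurableSet (orderedSimplex m t) := by
  have h : orderedSimplex m t = (⋂ i, {s | fprev s i < s i}) ∩ ⋂ i, {s | s i < t} := by
    ext
    simp [orderedSimplex]
  rw [h]
  exact (MeasurableSet.iInter fun i ↦ measurableSet_lt (by fun_prop) (by fun_prop)).inter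
    (MeasurableSet.iInter fun i ↦ measurableSet_lt (by fun_prop) (by fun_prop))

lemma cons_add_mem_orderedSimplex {n : ℕ} {t x : ℝ} {y : Fin n → ℝ} :
    (Fin.cons x (y + fun _ ↦ x) : Fin (n + 1) → ℝ) ∈ orderedSimplex (n + 1) t ↔
      x ∈ Set.Ioo 0 t ∧ y ∈ orderedSimplex n (t - x) := by
  simp only [orderedSimplex, Set.mem_ofPred_eq, Fin.forall_fin_succ, fprev_cons_zero,
    fprev_cons_add_succ, Fin.cons_zero, Fin.cons_succ, Pi.add_apply, add_lt_add_iff_right,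
    Set.mem_Ioo, lt_sub_iff_add_lt]
  tauto

lemma lintegral_orderedSimplex (m : ℕ) (α : Fin m → ℝ) (hα : ∀ i, 0 < α i)
    (t : ℝ) (ht : 0 < t) :
    ∫⁻ s, (orderedSimplex m t).indicator
        (fun s ↦ ENNReal.ofReal (∏ i, (s i - fprev s i) ^ (α i - 1))) s =
      ENNReal.ofReal
        (((∏ i, Real.Gamma (α i)) / Real.Gamma ((∑ i, α i) + 1)) * t ^ (∑ i, α i)) := by
  induction m generalizing t with
  | zero =>
    have h : orderedSimplex 0 t = Set.univ := by ext; simp [orderedSimplex]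
    simp [h, volume_pi]
  | succ n ih =>
    set A := ∑ i : Fin n, α i.succ with hA
    have hA0 : 0 ≤ A := Finset.sum_nonneg fun i _ ↦ (hα _).le
    set P := ∏ i : Fin n, Real.Gamma (α i.succ) with hP
    have hP0 : 0 < P := Finset.prod_pos fun i _ ↦ Real.Gamma_pos_of_pos (hα _)
    have hG : 0 < Real.Gamma (A + 1) := Real.Gamma_pos_of_pos (by linarith)
    set f : (Fin (n + 1) → ℝ) → ENNReal := (orderedSimplex (n + 1) t).indicator
        (fun s ↦ ENNReal.ofReal (∏ i, (s i - fprev s i) ^ (α i - 1))) with hf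
    have hfm : Measurable f :=
      Measurable.indicator (by fun_prop) (measurableSet_orderedSimplex _ _)
    have hpt (x : ℝ) (y : Fin n → ℝ) : f (Fin.cons x (y + fun _ ↦ x)) =
        (Set.Ioo 0 t).indicator (fun x ↦ ENNReal.ofReal (x ^ (α 0 - 1))) x *
          (orderedSimplex n (t - x)).indicator
            (fun s ↦ ENNReal.ofReal (∏ i, (s i - fprev s i) ^ (α i.succ - 1))) y := by
      by_cases hx : x ∈ Set.Ioo 0 t
      · by_cases hy : y ∈ orderedSimplex n (t - x)
        · rw [hf, Set.indicator_of_mem (cons_add_mem_orderedSimplex.2 ⟨hx, hy⟩),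
            Set.indicator_of_mem hx, Set.indicator_of_mem hy,
            ← ENNReal.ofReal_mul (rpow_nonneg hx.1.le _), Fin.prod_univ_succ]
          simp only [fprev_cons_zero, fprev_cons_add_succ, Fin.cons_zero, Fin.cons_succ,
            Pi.add_apply, add_sub_add_right_eq_sub, sub_zero]
        · rw [hf, Set.indicator_of_notMem (fun h ↦ hy (cons_add_mem_orderedSimplex.1 h).2),
            Set.indicator_of_notMem hy, mul_zero]
      · rw [hf, Set.indicator_of_notMem (fun h ↦ hx (cons_add_mem_orderedSimplex.1 h).1),
          Set.indicator_of_notMem hx, zero_mul]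
    have hinner (x : ℝ) : ∫⁻ y : Fin n → ℝ, f (Fin.cons x y) =
        ENNReal.ofReal (P / Real.Gamma (A + 1)) * (Set.Ioo 0 t).indicator
          (fun x ↦ ENNReal.ofReal (x ^ (α 0 - 1) * (t - x) ^ (A + 1 - 1))) x := by
      rw [← lintegral_add_right_eq_self (fun y ↦ f (Fin.cons x y)) (fun _ ↦ x)]
      simp_rw [hpt]
      by_cases hx : x ∈ Set.Ioo 0 t
      · rw [Set.indicator_of_mem hx, lintegral_const_mul' _ _ ENNReal.ofReal_ne_top,
          ih _ (fun i ↦ hα _) _ (sub_pos.2 hx.2), Set.indicator_of_mem hx,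
          ← ENNReal.ofReal_mul (rpow_nonneg hx.1.le _), ← ENNReal.ofReal_mul (by positivity)]
        congr 1
        rw [add_sub_cancel_right]
        ring
      · simp [Set.indicator_of_notMem hx]
    have hsplit : ∫⁻ s, f s = ∫⁻ x : ℝ, ∫⁻ y : Fin n → ℝ, f (Fin.cons x y) := by
      have hmp := (volume_preserving_piFinSuccAbove (fun _ : Fin (n + 1) ↦ ℝ) 0).symm
      rw [← hmp.lintegral_comp hfm, Measure.volume_eq_prod,
        lintegral_prod (fun p ↦ f ((MeasurableEquiv.piFinSuccAbove (fun _ ↦ ℝ) 0).symm p))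
          (hfm.comp (MeasurableEquiv.measurable _)).aemeasurable]
      simp only [MeasurableEquiv.piFinSuccAbove_symm_apply, Fin.insertNthEquiv_zero]
      rfl
    rw [hsplit]
    simp_rw [hinner]
    rw [lintegral_const_mul' _ _ ENNReal.ofReal_ne_top,
      lintegral_Ioo_rpow_mul_sub_rpow (hα 0) (by linarith) ht,
      ← ENNReal.ofReal_mul (by positivity), Fin.prod_univ_succ, Fin.sum_univ_succ, ← hA, ← hP,
      ProbabilityTheory.beta]
    congr 1
    rw [show α 0 + (A + 1) - 1 = α 0 + A by ring, ← add_assoc]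
    field_simp

/-- The Dirichlet integral over the ordered simplex
`{0 < s₁ < s₂ < … < s_m < t}`. -/
theorem dirichlet_integral (m : ℕ) (hm : 1 ≤ m) (α : Fin m → ℝ) (hα : ∀ i, 0 < α i)
    (t : ℝ) (ht : 0 < t) :
    (∫ s in {s : Fin m → ℝ | (∀ i, fprev s i < s i) ∧ ∀ i, s i < t},
        ∏ i, (s i - fprev s i) ^ (α i - 1)) =
      ((∏ i, Real.Gamma (α i)) / Real.Gamma ((∑ i, α i) + 1)) * t ^ (∑ i, α i) := by
  change ∫ s in orderedSimplex m t, _ = _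
  have hS := measurableSet_orderedSimplex m t
  rw [integral_eq_lintegral_of_nonneg_ae, ← lintegral_indicator hS,
    lintegral_orderedSimplex m α hα t ht, ENNReal.toReal_ofReal]
  · have hsum : 0 ≤ ∑ i, α i := Finset.sum_nonneg fun i _ ↦ (hα i).le
    have hG : 0 < Real.Gamma ((∑ i, α i) + 1) := Real.Gamma_pos_of_pos (by linarith)
    have hP : 0 < ∏ i, Real.Gamma (α i) :=
      Finset.prod_pos fun i _ ↦ Real.Gamma_pos_of_pos (hα i)
    positivity
  · exact ae_restrict_of_forall_mem hS fun s hs ↦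
      Finset.prod_nonneg fun i _ ↦ rpow_nonneg (sub_nonneg.2 (hs.1 i).le) _
  · exact Measurable.aestronglyMeasurable (by fun_prop)
end

section
/- Let d ≥ 1 be an integer and let q > 1 be a real number with d(q − 1) < 2q. Let (p_i)_{i ∈ ℕ} and (m_i)_{i ∈ ℕ} be sequences of real numbers with p_i ≥ 0 and m_i > 0 for every i, such that ∑_{i} p_i ≥ 1 and ∑_{i} m_i ≤ 1. Then ∑_{i} p_i^{2/(d(q−1))} · m_i^{1 − 2q/(d(q−1))} ≥ 1 (the left-hand side being a sum in [0, ∞]). (This is the reduced form of the variational problem characterizing the minimizer in the conditional LDP: note that 1 − 2q/(d(q−1)) < 0, so small masses m_i are penalized.) -/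
open scoped ENNReal

/-- The tangent-line inequality for the perspective `(p, m) ↦ p ^ a * m ^ (1 - a)` of the convex
function `x ↦ x ^ a`. -/
theorem mul_le_rpow_mul_rpow_one_sub_add {a p m : ℝ} (ha : 1 ≤ a) (hp : 0 ≤ p) (hm : 0 < m) :
    a * p ≤ p ^ a * m ^ (1 - a) + (a - 1) * m := by
  have hb := one_add_mul_self_le_rpow_one_add (s := p / m - 1) (by linarith [div_nonneg hp hm.le]) ha
  rw [add_sub_cancel, Real.div_rpow hp hm.le] at hb
  have h := mul_le_mul_of_nonneg_right hb hm.le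
  have h1 : (1 + a * (p / m - 1)) * m = a * p - (a - 1) * m := by field_simp; ring
  have h2 : p ^ a / m ^ a * m = p ^ a * m ^ (1 - a) := by
    rw [Real.rpow_sub hm, Real.rpow_one]; ring
  linarith

/-- If `p` has total mass at least one and `m` is positive of total mass at most one, then
`∑ p ^ a * m ^ (1 - a) ≥ 1` for every `a ≥ 1`. -/
theorem one_le_tsum_rpow_mul_rpow_one_sub {ι : Type*} {a : ℝ} (ha : 1 ≤ a) {p m : ι → ℝ}
    (hp : ∀ i, 0 ≤ p i) (hm : ∀ i, 0 < m i) (hps : 1 ≤ ∑' i, ENNReal.ofReal (p i))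
    (hms : ∑' i, ENNReal.ofReal (m i) ≤ 1) :
    1 ≤ ∑' i, ENNReal.ofReal (p i ^ a * m i ^ (1 - a)) := by
  have key : ENNReal.ofReal a ≤
      ∑' i, ENNReal.ofReal (p i ^ a * m i ^ (1 - a)) + ENNReal.ofReal (a - 1) := by
    calc ENNReal.ofReal a ≤ ENNReal.ofReal a * ∑' i, ENNReal.ofReal (p i) :=
          le_mul_of_one_le_right' hps
      _ = ∑' i, ENNReal.ofReal (a * p i) := by
          simp_rw [ENNReal.ofReal_mul (zero_le_one.trans ha), ENNReal.tsum_mul_left]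
      _ ≤ ∑' i, (ENNReal.ofReal (p i ^ a * m i ^ (1 - a)) +
            ENNReal.ofReal (a - 1) * ENNReal.ofReal (m i)) := by
          refine ENNReal.tsum_le_tsum fun i => ?_
          rw [← ENNReal.ofReal_mul (sub_nonneg.2 ha), ← ENNReal.ofReal_add
            (mul_nonneg (Real.rpow_nonneg (hp i) _) (Real.rpow_nonneg (hm i).le _))
            (mul_nonneg (sub_nonneg.2 ha) (hm i).le)]
          exact ENNReal.ofReal_le_ofReal (mul_le_rpow_mul_rpow_one_sub_add ha (hp i) (hm i))
      _ ≤ _ := by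
          rw [ENNReal.tsum_add, ENNReal.tsum_mul_left]
          gcongr
          exact mul_le_of_le_one_right' hms
  have h : ENNReal.ofReal a = 1 + ENNReal.ofReal (a - 1) := by
    rw [← ENNReal.ofReal_one, ← ENNReal.ofReal_add zero_le_one (sub_nonneg.2 ha), add_sub_cancel]
  rw [h] at key
  exact (ENNReal.add_le_add_iff_right ENNReal.ofReal_ne_top).1 key

theorem conditional_variational_reduction (d : ℕ) (hd : 1 ≤ d) (q : ℝ) (hq : 1 < q)
    (hsub : (d : ℝ) * (q - 1) < 2 * q)
    (p m : ℕ → ℝ) (hp : ∀ i, 0 ≤ p i) (hm : ∀ i, 0 < m i)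
    (hps : 1 ≤ ∑' i, ENNReal.ofReal (p i))
    (hms : ∑' i, ENNReal.ofReal (m i) ≤ 1) :
    1 ≤ ∑' i, ENNReal.ofReal
        (p i ^ (2 / ((d : ℝ) * (q - 1))) * m i ^ (1 - 2 * q / ((d : ℝ) * (q - 1)))) := by
  have hdq : 0 < (d : ℝ) * (q - 1) := mul_pos (by exact_mod_cast hd) (by linarith)
  have hqa : 2 * q / ((d : ℝ) * (q - 1)) = q * (2 / ((d : ℝ) * (q - 1))) := by ring
  have h1 : 1 < 2 * q / ((d : ℝ) * (q - 1)) := (one_lt_div hdq).2 hsub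
  have ha : 0 < 2 / ((d : ℝ) * (q - 1)) := by positivity
  rw [hqa] at h1 ⊢
  generalize 2 / ((d : ℝ) * (q - 1)) = a at *
  have hm1 : ∀ i, m i ≤ 1 := fun i =>
    ENNReal.ofReal_le_one.1 ((ENNReal.le_tsum i).trans hms)
  have hw : ∀ i, 1 ≤ m i ^ (1 - q * a) := fun i =>
    Real.one_le_rpow_of_pos_of_le_one_of_nonpos (hm i) (hm1 i) (by linarith)
  rcases le_total 1 a with h | h
  · refine (one_le_tsum_rpow_mul_rpow_one_sub h hp hm hps hms).trans
      (ENNReal.tsum_le_tsum fun i => ENNReal.ofReal_le_ofReal ?_)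
    exact mul_le_mul_of_nonneg_left
      (Real.rpow_le_rpow_of_exponent_ge (hm i) (hm1 i) (by nlinarith)) (Real.rpow_nonneg (hp i) _)
  · by_cases hp1 : ∀ i, p i ≤ 1
    · refine hps.trans (ENNReal.tsum_le_tsum fun i => ENNReal.ofReal_le_ofReal ?_)
      have hpa : p i ≤ p i ^ a := Real.self_le_rpow_of_le_one (hp i) (hp1 i) h
      exact hpa.trans (le_mul_of_one_le_right (Real.rpow_nonneg (hp i) _) (hw i))
    · push Not at hp1
      obtain ⟨i, hi⟩ := hp1
      refine le_trans ?_ (ENNReal.le_tsum i)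
      rw [ENNReal.one_le_ofReal]
      exact one_le_mul_of_one_le_of_one_le (Real.one_le_rpow hi.le ha.le) (hw i)
end

section
/- Let θ ∈ (0, 1), let γ > 0 with γθ < 1, and let A > 0. Then for all sequences (k_i)_{i ∈ ℕ} and (m_i)_{i ∈ ℕ} of nonnegative real numbers with ∑_i k_i < ∞ and ∑_i m_i ≤ 1, one has A · ( ∑_i k_i^{θ} m_i^{1−θ} )^{γ} − (1/2) ∑_i k_i ≤ (1 − γθ) · (2γθ)^{γθ/(1−γθ)} · A^{1/(1−γθ)}, and the right-hand side equals sup_{y ≥ 0} { A y^{γθ} − y/2 }. (Applied with θ = d(q−1)/(2q) and A = κ_{d,q}^{2γ}, where κ_{d,q} is the optimal Gagliardo–Nirenberg constant, this gives the explicit value of the tilted variational problem ρ_{d,q,γ}.) -/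
/-- Hölder's inequality with exponents `1 / θ` and `1 / (1 - θ)`, the second factor having total
mass at most one. -/
theorem tsum_rpow_mul_rpow_le {θ : ℝ} (hθ : θ ∈ Set.Ioo (0 : ℝ) 1) {k m : ℕ → ℝ}
    (hk : ∀ i, 0 ≤ k i) (hm : ∀ i, 0 ≤ m i) (hks : Summable k) (hms : Summable m)
    (hm1 : ∑' i, m i ≤ 1) :
    ∑' i, k i ^ θ * m i ^ (1 - θ) ≤ (∑' i, k i) ^ θ := by
  obtain ⟨h0, h1⟩ := hθ
  have h1' : 0 < 1 - θ := sub_pos.2 h1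
  have hpq : (1 / θ).HolderConjugate (1 / (1 - θ)) := by
    rw [Real.holderConjugate_iff]
    exact ⟨(one_lt_div h0).2 h1, by simp⟩
  have hkp (i : ℕ) : (k i ^ θ) ^ (1 / θ) = k i := by
    rw [one_div, Real.rpow_rpow_inv (hk i) h0.ne']
  have hmp (i : ℕ) : (m i ^ (1 - θ)) ^ (1 / (1 - θ)) = m i := by
    rw [one_div, Real.rpow_rpow_inv (hm i) h1'.ne']
  have key := Real.inner_le_Lp_mul_Lq_tsum_of_nonneg hpq
    (fun i => Real.rpow_nonneg (hk i) θ) (fun i => Real.rpow_nonneg (hm i) (1 - θ))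
    (by simpa only [hkp] using hks) (by simpa only [hmp] using hms)
  simp only [hkp, hmp, one_div_one_div] at key
  exact key.trans (mul_le_of_le_one_right (Real.rpow_nonneg (tsum_nonneg hk) θ)
    (Real.rpow_le_one (tsum_nonneg hm) hm1 h1'.le))

/-- The maximum of `y ↦ A * y ^ s - y / 2` on `[0, ∞)`. -/
theorem isGreatest_mul_rpow_sub_half {s A : ℝ} (hs0 : 0 < s) (hs1 : s < 1) (hA : 0 < A) :
    IsGreatest {v : ℝ | ∃ y : ℝ, 0 ≤ y ∧ v = A * y ^ s - y / 2}
      ((1 - s) * (2 * s) ^ (s / (1 - s)) * A ^ (1 / (1 - s))) := by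
  have h1 : 0 < 1 - s := sub_pos.2 hs1
  rw [mul_assoc]
  set C : ℝ := (2 * s) ^ (s / (1 - s)) * A ^ (1 / (1 - s)) with hC
  have hC0 : 0 < C := by positivity
  have hCs : C ^ (1 - s) = (2 * s) ^ s * A := by
    rw [hC, Real.mul_rpow (by positivity) (by positivity), ← Real.rpow_mul (by positivity),
      ← Real.rpow_mul hA.le, div_mul_cancel₀ _ h1.ne', div_mul_cancel₀ _ h1.ne', Real.rpow_one]
  have hscale {z : ℝ} (hz : 0 ≤ z) : A * (2 * s * z) ^ s = C ^ (1 - s) * z ^ s := by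
    rw [hCs, Real.mul_rpow (by positivity) hz]
    ring
  refine ⟨⟨2 * s * C, by positivity, ?_⟩, ?_⟩
  · rw [hscale hC0.le, ← Real.rpow_add hC0, sub_add_cancel, Real.rpow_one]
    ring
  · rintro _ ⟨y, hy, rfl⟩
    obtain ⟨z, hz, rfl⟩ : ∃ z, 0 ≤ z ∧ 2 * s * z = y :=
      ⟨y / (2 * s), by positivity, mul_div_cancel₀ _ (by positivity)⟩
    rw [hscale hz]
    linarith [Real.geom_mean_le_arith_mean2_weighted h1.le hs0.le hC0.le hz (sub_add_cancel 1 s)]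

theorem tilted_variational_value (θ γ A : ℝ) (hθ : θ ∈ Set.Ioo (0 : ℝ) 1)
    (hγ : 0 < γ) (hγθ : γ * θ < 1) (hA : 0 < A)
    (k m : ℕ → ℝ) (hk : ∀ i, 0 ≤ k i) (hm : ∀ i, 0 ≤ m i)
    (hks : Summable k) (hms : Summable m) (hm1 : ∑' i, m i ≤ 1) :
    A * (∑' i, k i ^ θ * m i ^ (1 - θ)) ^ γ - (1 / 2) * ∑' i, k i ≤
        (1 - γ * θ) * (2 * γ * θ) ^ (γ * θ / (1 - γ * θ)) * A ^ (1 / (1 - γ * θ)) ∧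
      (1 - γ * θ) * (2 * γ * θ) ^ (γ * θ / (1 - γ * θ)) * A ^ (1 / (1 - γ * θ)) =
        sSup {v : ℝ | ∃ y : ℝ, 0 ≤ y ∧ v = A * y ^ (γ * θ) - y / 2} := by
  have hmax := isGreatest_mul_rpow_sub_half (mul_pos hγ hθ.1) hγθ hA
  rw [← mul_assoc 2 γ θ] at hmax
  refine ⟨?_, hmax.csSup_eq.symm⟩
  have hK : 0 ≤ ∑' i, k i := tsum_nonneg hk
  have hS : (∑' i, k i ^ θ * m i ^ (1 - θ)) ^ γ ≤ (∑' i, k i) ^ (γ * θ) := by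
    rw [mul_comm γ θ, Real.rpow_mul hK]
    exact Real.rpow_le_rpow
      (tsum_nonneg fun i => mul_nonneg (Real.rpow_nonneg (hk i) _) (Real.rpow_nonneg (hm i) _))
      (tsum_rpow_mul_rpow_le hθ hk hm hks hms hm1) hγ.le
  linarith [hmax.2 ⟨_, hK, rfl⟩, mul_le_mul_of_nonneg_left hS hA.le]
end

section
/- For every real number c with 0 < c ≤ 1, lim_{x → ∞} (1/x) · log ( ∑_{m=0}^{∞} (x^m / m!)^{c} ) = c. (This asymptotic for the fractional-power exponential series is the final step converting the moment bounds E|X|^m ≤ C^m (m!)^p (a^m/m!)^{η} into exponential-moment bounds of the form E exp{|X|^{1/p}} ≤ exp{O(a)}.) -/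
open Filter

theorem fractional_exp_term_le {c r x : ℝ} (hc : 0 < c) (hr : 0 < r) (hx : 0 ≤ x) (m : ℕ) :
    (x ^ m / (Nat.factorial m : ℝ)) ^ c ≤ Real.exp (c * r * x) * (r ^ (-c)) ^ m := by
  have hle : x ^ m / (Nat.factorial m : ℝ) ≤ Real.exp (r * x) * (r⁻¹) ^ m := by
    have h := Real.pow_div_factorial_le_exp (r * x) (by positivity) m
    calc x ^ m / (Nat.factorial m : ℝ)
        = (r * x) ^ m / (Nat.factorial m : ℝ) * (r⁻¹) ^ m := by
          rw [mul_pow, inv_pow]; field_simp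
      _ ≤ _ := by gcongr
  calc (x ^ m / (Nat.factorial m : ℝ)) ^ c
      ≤ (Real.exp (r * x) * (r⁻¹) ^ m) ^ c := by gcongr
    _ = Real.exp (c * r * x) * (r ^ (-c)) ^ m := by
      rw [Real.mul_rpow (by positivity) (by positivity), ← Real.exp_mul,
        ← Real.rpow_pow_comm (by positivity), Real.inv_rpow hr.le, Real.rpow_neg hr.le]
      ring_nf

theorem summable_fractional_exp {c x : ℝ} (hc : 0 < c) (hx : 0 ≤ x) :
    Summable fun m : ℕ => (x ^ m / (Nat.factorial m : ℝ)) ^ c :=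
  Summable.of_nonneg_of_le (fun _ => by positivity)
    (fractional_exp_term_le hc (by norm_num : (0 : ℝ) < 2) hx)
    ((summable_geometric_of_lt_one (by positivity)
      (Real.rpow_lt_one_of_one_lt_of_neg (by norm_num) (by linarith))).mul_left _)

theorem tsum_fractional_exp_le {c r x : ℝ} (hc : 0 < c) (hr : 1 < r) (hx : 0 ≤ x) :
    ∑' m : ℕ, (x ^ m / (Nat.factorial m : ℝ)) ^ c ≤
      Real.exp (c * r * x) * (1 - r ^ (-c))⁻¹ := by
  have h0 : 0 ≤ r ^ (-c) := Real.rpow_nonneg (by linarith) _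
  have h1 : r ^ (-c) < 1 := Real.rpow_lt_one_of_one_lt_of_neg hr (by linarith)
  rw [← tsum_geometric_of_lt_one h0 h1, ← tsum_mul_left]
  exact (summable_fractional_exp hc hx).tsum_le_tsum
    (fractional_exp_term_le hc (by linarith) hx)
    ((summable_geometric_of_lt_one h0 h1).mul_left _)

theorem exp_mul_le_tsum_fractional_exp {c x : ℝ} (hc0 : 0 < c) (hc1 : c ≤ 1) (hx : 0 ≤ x) :
    Real.exp (c * x) ≤ ∑' m : ℕ, (x ^ m / (Nat.factorial m : ℝ)) ^ c := by
  have hterm (m : ℕ) : Real.exp (c * x - x) * (x ^ m / (Nat.factorial m : ℝ)) ≤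
      (x ^ m / (Nat.factorial m : ℝ)) ^ c := by
    set a := x ^ m / (Nat.factorial m : ℝ)
    have ha : 0 ≤ a := by positivity
    have hb : a * Real.exp (-x) ≤ 1 := by
      rw [Real.exp_neg, ← div_eq_mul_inv, div_le_one (Real.exp_pos x)]
      exact Real.pow_div_factorial_le_exp x hx m
    calc Real.exp (c * x - x) * a = Real.exp (c * x) * (a * Real.exp (-x)) := by
          rw [sub_eq_add_neg, Real.exp_add]; ring
      _ ≤ Real.exp (c * x) * (a * Real.exp (-x)) ^ c := by
          gcongr
          exact Real.self_le_rpow_of_le_one (by positivity) hb hc1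
      _ = a ^ c := by
          rw [Real.mul_rpow ha (Real.exp_pos _).le, ← Real.exp_mul, mul_left_comm,
            ← Real.exp_add]
          simp [mul_comm c]
  calc Real.exp (c * x) = ∑' m : ℕ, Real.exp (c * x - x) * (x ^ m / (Nat.factorial m : ℝ)) := by
        rw [tsum_mul_left, ← congrFun (Real.exp_eq_exp_ℝ.trans
          NormedSpace.exp_eq_tsum_div) x, ← Real.exp_add]
        simp
    _ ≤ _ := ((Real.summable_pow_div_factorial x).mul_left _).tsum_le_tsum hterm
        (summable_fractional_exp hc0 hx)

theorem log_fractional_exp_series_asymptotics (c : ℝ) (hc0 : 0 < c) (hc1 : c ≤ 1) :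
    Tendsto (fun x : ℝ =>
        (1 / x) * Real.log (∑' m : ℕ, (x ^ m / (Nat.factorial m : ℝ)) ^ c))
      atTop (nhds c) := by
  refine tendsto_order.2 ⟨fun a ha => ?_, fun b hb => ?_⟩
  · filter_upwards [eventually_gt_atTop 0] with x hx
    refine ha.trans_le ?_
    rw [one_div, inv_mul_eq_div, le_div_iff₀ hx, ← Real.log_exp (c * x)]
    exact Real.log_le_log (Real.exp_pos _) (exp_mul_le_tsum_fractional_exp hc0 hc1 hx.le)
  · obtain ⟨r, hr, hrb⟩ : ∃ r, 1 < r ∧ r < b / c :=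
      exists_between ((one_lt_div hc0).2 hb)
    have hcr : c * r < b := by rwa [lt_div_iff₀ hc0, mul_comm] at hrb
    have hpos : 0 < 1 - r ^ (-c) :=
      sub_pos.2 (Real.rpow_lt_one_of_one_lt_of_neg hr (by linarith))
    filter_upwards [eventually_gt_atTop 0,
      eventually_gt_atTop (Real.log (1 - r ^ (-c))⁻¹ / (b - c * r))] with x hx hxK
    rw [div_lt_iff₀ (sub_pos.2 hcr)] at hxK
    rw [one_div, inv_mul_eq_div, div_lt_iff₀ hx]
    have h := Real.log_le_log
      ((Real.exp_pos _).trans_le (exp_mul_le_tsum_fractional_exp hc0 hc1 hx.le))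
      (tsum_fractional_exp_le hc0 hr hx.le)
    rw [Real.log_mul (Real.exp_pos _).ne' (inv_pos.2 hpos).ne', Real.log_exp] at h
    linarith
end

section
/- (Profile decomposition for tuples of probability measures.) Let d ≥ 1 and p ≥ 1 be integers, and for each n ∈ ℕ let (μ_n^1, …, μ_n^p) be a p-tuple of Borel probability measures on ℝ^d. Then there exist: a strictly increasing sequence (n_k) of indices, an at most countable index set I, finite Borel measures α_i^j on ℝ^d for i ∈ I and 1 ≤ j ≤ p, finite Borel measures α_{i,k}^j and β_k^j on ℝ^d, and points x_{i,k} ∈ ℝ^d for i ∈ I and k ∈ ℕ, such that: (1) for every k and every j, μ_{n_k}^j = ∑_{i ∈ I} α_{i,k}^j + β_k^j; (2) for every i ∈ I and every j, the pushforward of α_{i,k}^j under the translation y ↦ y + x_{i,k} converges weakly to α_i^j as k → ∞ (note the translation point x_{i,k} is the same for all j); (3) each β_k^j totally disintegrates, i.e., for every R > 0, sup_{x ∈ ℝ^d} β_k^j(B(x, R)) → 0 as k → ∞; (4) the shift sequences are widely separated, i.e., for all i₁ ≠ i₂ in I, |x_{i₁,k} − x_{i₂,k}| → ∞ as k → ∞.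 -/
open MeasureTheory Filter Topology
open scoped ENNReal

/-- If the mass of `ν` is less than `N * ε`, fewer than `N` points lie close to the centers of all
balls of radius `r` and mass at least `ε`. -/
theorem exists_finset_near_heavy_balls {E : Type*} [PseudoMetricSpace E] [MeasurableSpace E]
    [OpensMeasurableSpace E] (ν : Measure E) {r : ℝ} (hr : 0 < r) {ε : ℝ≥0∞} {N : ℕ}
    (hN : ν Set.univ < N * ε) :
    ∃ s : Finset E, s.card < N ∧
      ∀ y, ε ≤ ν (Metric.ball y r) → ∃ x ∈ s, dist y x < 2 * r := by
  classical
  let P : ℕ → Prop := fun n => ∃ s : Finset E, s.card = n ∧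
    (s : Set E).PairwiseDisjoint (fun x => Metric.ball x r) ∧ ∀ x ∈ s, ε ≤ ν (Metric.ball x r)
  have hPN : ∀ n, P n → n < N := by
    rintro n ⟨s, rfl, hs, hsε⟩
    by_contra! hle
    have h1 : (s.card : ℝ≥0∞) * ε ≤ ν Set.univ := by
      calc (s.card : ℝ≥0∞) * ε = ∑ _x ∈ s, ε := by simp
        _ ≤ ∑ x ∈ s, ν (Metric.ball x r) := Finset.sum_le_sum hsε
        _ = ν (⋃ x ∈ s, Metric.ball x r) :=
          (measure_biUnion_finset hs fun x _ => Metric.isOpen_ball.measurableSet).symm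
        _ ≤ ν Set.univ := measure_mono (Set.subset_univ _)
    have h2 : (N : ℝ≥0∞) * ε ≤ s.card * ε := by gcongr
    exact absurd (hN.trans_le (h2.trans h1)) (lt_irrefl _)
  have hP0 : P 0 := ⟨∅, by simp⟩
  have hmax : P (Nat.findGreatest P N) := Nat.findGreatest_spec (Nat.zero_le N) hP0
  obtain ⟨s, hcard, hs, hsε⟩ := hmax
  refine ⟨s, hcard ▸ hPN _ ⟨s, hcard, hs, hsε⟩, fun y hy => ?_⟩
  by_contra! hfar
  have hys : y ∉ s := fun h => by
    have := hfar y h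
    rw [dist_self] at this
    linarith
  have hP : P (s.card + 1) := by
    refine ⟨insert y s, Finset.card_insert_of_notMem hys, ?_, ?_⟩
    · rw [Finset.coe_insert]
      refine hs.insert fun x hx _ => Metric.ball_disjoint_ball ?_
      linarith [hfar x hx]
    · simpa [hy] using hsε
  have := Nat.le_findGreatest (hPN _ hP).le hP
  omega

/-- A sequence of finite measures whose masses converge and which satisfies the liminf inequality
on open sets converges weakly. -/
theorem tendsto_integral_of_forall_isOpen_le_liminf {E : Type*} [TopologicalSpace E]
    [MeasurableSpace E] [OpensMeasurableSpace E] {μ : Measure E} [IsFiniteMeasure μ]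
    {μs : ℕ → Measure E} [∀ k, IsFiniteMeasure (μs k)]
    (hopen : ∀ G, IsOpen G → μ G ≤ liminf (fun k => μs k G) atTop)
    (hmass : Tendsto (fun k => μs k Set.univ) atTop (𝓝 (μ Set.univ)))
    (f : BoundedContinuousFunction E ℝ) :
    Tendsto (fun k => ∫ y, f y ∂(μs k)) atTop (𝓝 (∫ y, f y ∂μ)) := by
  have key : ∀ g : BoundedContinuousFunction E ℝ, 0 ≤ g → ∀ a < ∫ y, g y ∂μ,
      ∀ᶠ k in atTop, a < ∫ y, g y ∂(μs k) := by
    intro g hg a ha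
    have hlim := lintegral_le_liminf_lintegral_of_forall_isOpen_measure_le_liminf_measure
      g.continuous hg hopen
    have hconv : ∀ (ν : Measure E) [IsFiniteMeasure ν],
        ENNReal.ofReal (∫ y, g y ∂ν) = ∫⁻ y, ENNReal.ofReal (g y) ∂ν := fun ν _ =>
      ofReal_integral_eq_lintegral_ofReal (g.integrable ν) (Eventually.of_forall hg)
    simp_rw [← hconv] at hlim
    rcases lt_or_ge a 0 with ha0 | ha0
    · exact Eventually.of_forall fun k => ha0.trans_le (integral_nonneg hg)
    · have := eventually_lt_of_lt_liminf
        (((ENNReal.ofReal_lt_ofReal_iff (ha0.trans_lt ha)).2 ha).trans_le hlim)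
      filter_upwards [this] with k hk
      exact (ENNReal.ofReal_lt_ofReal_iff_of_nonneg ha0).1 hk
  have hreal : Tendsto (fun k => (μs k).real Set.univ) atTop (𝓝 (μ.real Set.univ)) :=
    (ENNReal.tendsto_toReal (measure_ne_top _ _)).comp hmass
  have hup : ∀ h : BoundedContinuousFunction E ℝ, ∀ a < ∫ y, h y ∂μ,
      ∀ᶠ k in atTop, a < ∫ y, h y ∂(μs k) := by
    intro h a ha
    have hadd : ∀ (ν : Measure E) [IsFiniteMeasure ν],
        ∫ y, (h + BoundedContinuousFunction.const E ‖h‖) y ∂ν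
          = ∫ y, h y ∂ν + ν.real Set.univ * ‖h‖ := by
      intro ν _
      simp only [BoundedContinuousFunction.coe_add, Pi.add_apply,
        BoundedContinuousFunction.const_apply]
      rw [integral_add (h.integrable ν) (integrable_const _), integral_const, smul_eq_mul]
    have hpos : 0 ≤ h + BoundedContinuousFunction.const E ‖h‖ := fun y => by
      have := neg_le_of_abs_le (h.norm_coe_le_norm y)
      change 0 ≤ h y + ‖h‖
      linarith
    set b := ∫ y, h y ∂μ with hb
    have h1 := key _ hpos ((a + b) / 2 + μ.real Set.univ * ‖h‖) (by rw [hadd]; linarith)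
    have h2 := (hreal.mul_const ‖h‖).eventually
      (gt_mem_nhds (show _ < μ.real Set.univ * ‖h‖ + (b - a) / 2 by linarith))
    filter_upwards [h1, h2] with k hk1 hk2
    rw [hadd] at hk1
    linarith
  refine tendsto_order.2 ⟨hup f, fun a ha => ?_⟩
  have := hup (-f) (-a) (by simpa [integral_neg] using ha)
  filter_upwards [this] with k hk
  simpa [integral_neg] using hk

/-- Restricting to sets that eventually contain every ball, without asymptotically picking up
mass beyond that of the vague limit, turns vague convergence into weak convergence. -/
theorem tendsto_integral_restrict {E : Type*} [PseudoMetricSpace E] [MeasurableSpace E]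
    [OpensMeasurableSpace E] {μ : Measure E} [IsFiniteMeasure μ] {μs : ℕ → Measure E}
    [∀ k, IsFiniteMeasure (μs k)] (x : E) {A : ℕ → Set E} {R : ℕ → ℕ} (hR : Tendsto R atTop atTop)
    (hopen : ∀ G, IsOpen G → μ G ≤ liminf (fun k => μs k G) atTop)
    (hA : ∀ᶠ k in atTop, Metric.ball x (R k) ⊆ A k)
    (hmass : ∀ᶠ k in atTop, μs k (A k) ≤ μ Set.univ + (R k : ℝ≥0∞)⁻¹)
    (f : BoundedContinuousFunction E ℝ) :
    Tendsto (fun k => ∫ y, f y ∂((μs k).restrict (A k))) atTop (𝓝 (∫ y, f y ∂μ)) := by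
  have hopen' : ∀ G, IsOpen G → μ G ≤ liminf (fun k => (μs k).restrict (A k) G) atTop := by
    intro G hG
    have hmono : Monotone fun m : ℕ => G ∩ Metric.ball x m := fun m n hmn =>
      Set.inter_subset_inter_right _ (Metric.ball_subset_ball (by exact_mod_cast hmn))
    have hsup : μ G = ⨆ m : ℕ, μ (G ∩ Metric.ball x m) := by
      rw [← hmono.measure_iUnion, ← Set.inter_iUnion, Metric.iUnion_ball_nat, Set.inter_univ]
    rw [hsup]
    refine iSup_le fun m => (hopen _ (hG.inter Metric.isOpen_ball)).trans ?_
    refine liminf_le_liminf ?_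
    filter_upwards [hA, hR.eventually_ge_atTop m] with k hk hm
    rw [Measure.restrict_apply hG.measurableSet]
    refine measure_mono (Set.inter_subset_inter_right _ ((Metric.ball_subset_ball ?_).trans hk))
    exact_mod_cast hm
  refine tendsto_integral_of_forall_isOpen_le_liminf hopen' ?_ f
  refine tendsto_of_le_liminf_of_limsup_le (hopen' _ isOpen_univ) ?_
  have hlim : Tendsto (fun k => μ Set.univ + (R k : ℝ≥0∞)⁻¹) atTop (𝓝 (μ Set.univ)) := by
    simpa using tendsto_const_nhds.add (ENNReal.tendsto_inv_nat_nhds_zero.comp hR)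
  rw [← hlim.limsup_eq]
  refine limsup_le_limsup ?_
  filter_upwards [hmass] with k hk
  simpa using hk

/-- Simultaneous extraction of vague limits for countably many sequences of probability measures
and of limits in `[0, ∞]` for countably many sequences of extended nonnegative reals. -/
theorem exists_subseq_vague_limits {E : Type*} [NormedAddCommGroup E] [InnerProductSpace ℝ E]
    [FiniteDimensional ℝ E] [MeasurableSpace E] [BorelSpace E] {ι κ : Type*} [Countable ι]
    [Countable κ] (Q : ι → ℕ → Measure E) [∀ i n, IsProbabilityMeasure (Q i n)]
    (D : κ → ℕ → ℝ≥0∞) :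
    ∃ φ : ℕ → ℕ, StrictMono φ ∧ ∃ (α : ι → Measure E) (L : κ → ℝ≥0∞),
      (∀ i, IsFiniteMeasure (α i)) ∧
      (∀ i G, IsOpen G → α i G ≤ liminf (fun k => Q i (φ k) G) atTop) ∧
      (∀ i F, IsCompact F → limsup (fun k => Q i (φ k) F) atTop ≤ α i F) ∧
      ∀ a, Tendsto (fun k => D a (φ k)) atTop (𝓝 (L a)) := by
  let K := Metric.closedBall (0 : E) 1
  have : CompactSpace K := isCompact_iff_compactSpace.1 (isCompact_closedBall 0 1)
  let h : E → K := fun x => ⟨Homeomorph.unitBall x, Metric.ball_subset_closedBall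
    (Homeomorph.unitBall x).2⟩
  have hemb : IsOpenEmbedding h := by
    have h1 : IsOpenEmbedding (Set.inclusion
        (Metric.ball_subset_closedBall : Metric.ball (0 : E) 1 ⊆ Metric.closedBall 0 1)) := by
      refine ⟨IsEmbedding.inclusion _, ?_⟩
      rw [Set.range_inclusion]
      exact Metric.isOpen_ball.preimage continuous_subtype_val
    exact h1.comp Homeomorph.unitBall.isOpenEmbedding
  have hmeas : MeasurableEmbedding h := hemb.measurableEmbedding
  have hprob : ∀ i n, IsProbabilityMeasure ((Q i n).map h) := fun i n =>
    Measure.isProbabilityMeasure_map hmeas.measurable.aemeasurable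
  let u : ℕ → (ι → ProbabilityMeasure K) × (κ → ℝ≥0∞) := fun n =>
    (fun i => ⟨(Q i n).map h, hprob i n⟩, fun a => D a n)
  obtain ⟨⟨M, L⟩, φ, hφ, hlim⟩ := CompactSpace.tendsto_subseq u
  rw [Prod.tendsto_iff] at hlim
  have hM := fun i => tendsto_pi_nhds.1 hlim.1 i
  have happly : ∀ i n (s : Set E), (Q i n).map h (h '' s) = Q i n s := fun i n s => by
    rw [hmeas.map_apply, Set.preimage_image_eq _ hmeas.injective]
  refine ⟨φ, hφ, fun i => (M i : Measure K).comap h, L, ?_, ?_, ?_,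
    fun a => tendsto_pi_nhds.1 hlim.2 a⟩
  · intro i
    refine ⟨?_⟩
    rw [hmeas.comap_apply]
    exact measure_lt_top _ _
  · intro i G hG
    have := ProbabilityMeasure.le_liminf_measure_open_of_tendsto (hM i) (hemb.isOpenMap G hG)
    rw [hmeas.comap_apply]
    refine this.trans_eq (congrArg (fun v => liminf v atTop) (funext fun k => happly i (φ k) G))
  · intro i F hF
    have := ProbabilityMeasure.limsup_measure_closed_le_of_tendsto (hM i)
      (hF.image hemb.continuous).isClosed
    rw [hmeas.comap_apply]
    refine Eq.trans_le (congrArg (fun v => limsup v atTop)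
      (funext fun k => (happly i (φ k) F).symm)) this

/-- If each of countably many properties holds eventually, then there is a slowly growing rate
along which they hold. -/
theorem exists_tendsto_atTop_forall_of_eventually {P : ℕ → ℕ → Prop} (h0 : ∀ k, P 0 k)
    (hP : ∀ m, ∀ᶠ k in atTop, P m k) :
    ∃ R : ℕ → ℕ, Tendsto R atTop atTop ∧ ∀ k, P (R k) k := by
  classical
  refine ⟨fun k => Nat.findGreatest (fun m => P m k) k, tendsto_atTop.2 fun m => ?_, fun k =>
    Nat.findGreatest_spec (P := fun m => P m k) (Nat.zero_le k) (h0 k)⟩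
  filter_upwards [hP m, eventually_ge_atTop m] with k hk hmk
  exact Nat.le_findGreatest hmk hk

/-- Measures of uniformly bounded mass admit countably many sequences of centers such that, at each
fixed scale, every heavy ball is close to one of boundedly many of the centers. -/
theorem exists_centers_near_heavy_balls {E : Type*} [PseudoMetricSpace E] [Inhabited E]
    [MeasurableSpace E] [OpensMeasurableSpace E] (ν : ℕ → Measure E) (C : ℕ)
    (hC : ∀ n, ν n Set.univ ≤ C) :
    ∃ c : ℕ → ℕ → E, ∀ m : ℕ, 0 < m → ∃ N : ℕ, ∀ n y,
      (m : ℝ≥0∞)⁻¹ ≤ ν n (Metric.ball y m) → ∃ i < N, dist y (c i n) < 2 * m := by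
  have hfin : ∀ m n : ℕ, ∃ s : Finset E, 0 < m → s.card < C * m + 1 ∧
      ∀ y, (m : ℝ≥0∞)⁻¹ ≤ ν n (Metric.ball y m) → ∃ x ∈ s, dist y x < 2 * m := by
    intro m n
    rcases Nat.eq_zero_or_pos m with rfl | hm
    · exact ⟨∅, fun h => absurd h (lt_irrefl 0)⟩
    · have hm0 : (m : ℝ≥0∞) ≠ 0 := by exact_mod_cast hm.ne'
      have hN : ν n Set.univ < ((C * m + 1 : ℕ) : ℝ≥0∞) * (m : ℝ≥0∞)⁻¹ := by
        refine (hC n).trans_lt ?_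
        push_cast
        rw [add_mul, mul_assoc, ENNReal.mul_inv_cancel hm0 (ENNReal.natCast_ne_top m), mul_one,
          one_mul]
        exact ENNReal.lt_add_right (ENNReal.natCast_ne_top C)
          (ENNReal.inv_ne_zero.2 (ENNReal.natCast_ne_top m))
      obtain ⟨s, hs⟩ := exists_finset_near_heavy_balls (ν n)
        (r := m) (by exact_mod_cast hm) hN
      exact ⟨s, fun _ => hs⟩
  choose s hs using hfin
  refine ⟨fun i n => (s i.unpair.1 n).toList.getD i.unpair.2 default, fun m hm =>
    ⟨Nat.pair m (C * m + 1), fun n y hy => ?_⟩⟩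
  obtain ⟨x, hx, hxy⟩ := (hs m n hm).2 y hy
  obtain ⟨l, hl, rfl⟩ := List.mem_iff_getElem.1 (Finset.mem_toList.2 hx)
  refine ⟨Nat.pair m l, Nat.pair_lt_pair_right m ?_, ?_⟩
  · rw [Finset.length_toList] at hl
    exact hl.trans (hs m n hm).1
  · simpa [List.getElem?_eq_getElem hl] using hxy

theorem profile_decomposition_tuples (d p : ℕ) (hd : 1 ≤ d) (hp : 1 ≤ p)
    (μ : ℕ → Fin p → Measure (EuclideanSpace ℝ (Fin d)))
    (hμ : ∀ n j, IsProbabilityMeasure (μ n j)) :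
    ∃ φ : ℕ → ℕ, StrictMono φ ∧
      ∃ (I : Type) (_ : Countable I)
        (α : I → Fin p → Measure (EuclideanSpace ℝ (Fin d)))
        (αk : I → ℕ → Fin p → Measure (EuclideanSpace ℝ (Fin d)))
        (β : ℕ → Fin p → Measure (EuclideanSpace ℝ (Fin d)))
        (x : I → ℕ → EuclideanSpace ℝ (Fin d)),
        (∀ i j, IsFiniteMeasure (α i j)) ∧
        (∀ i k j, IsFiniteMeasure (αk i k j)) ∧
        (∀ k j, IsFiniteMeasure (β k j)) ∧
        -- (1) decomposition of the subsequence
        (∀ k j, μ (φ k) j = Measure.sum (fun i => αk i k j) + β k j) ∧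
        -- (2) the recentered pieces converge weakly, with a common translation point
        (∀ i j (f : BoundedContinuousFunction (EuclideanSpace ℝ (Fin d)) ℝ),
          Tendsto (fun k => ∫ y, f y ∂((αk i k j).map (fun y => y + x i k)))
            atTop (𝓝 (∫ y, f y ∂(α i j)))) ∧
        -- (3) the remainders totally disintegrate
        (∀ j (R : ℝ), 0 < R →
          Tendsto (fun k => ⨆ c : EuclideanSpace ℝ (Fin d), β k j (Metric.ball c R))
            atTop (𝓝 (0 : ℝ≥0∞))) ∧
        -- (4) distinct shift sequences are widely separated
        (∀ i₁ i₂ : I, i₁ ≠ i₂ →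
          Tendsto (fun k => ‖x i₁ k - x i₂ k‖) atTop atTop) := by
  obtain ⟨c, hc⟩ := exists_centers_near_heavy_balls (fun n => ∑ j, μ n j) p
    (fun n => by simp [Measure.finsetSum_apply])
  have hshift : ∀ i n, Measurable fun y : EuclideanSpace ℝ (Fin d) => y + -c i n := fun i n =>
    measurable_id.add_const _
  have hQ : ∀ (a : ℕ × Fin p) (n : ℕ),
      IsProbabilityMeasure ((μ n a.2).map fun y => y + -c a.1 n) := fun a n =>
    Measure.isProbabilityMeasure_map (hshift _ _).aemeasurable
  obtain ⟨φ, hφ, α, L, hαfin, hαopen, hαcompact, hL⟩ := exists_subseq_vague_limits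
    (fun (a : ℕ × Fin p) (n : ℕ) => (μ n a.2).map fun y => y + -c a.1 n)
    (fun (a : ℕ × ℕ) (n : ℕ) => edist (c a.1 n) (c a.2 n))
  have hLself : ∀ i, L (i, i) = 0 := fun i =>
    tendsto_nhds_unique (hL (i, i)) (by simp)
  have hLsymm : ∀ i i', L (i, i') = L (i', i) := fun i i' =>
    tendsto_nhds_unique (hL (i, i')) (by simpa only [edist_comm] using hL (i', i))
  have hLtri : ∀ i i' i'', L (i, i'') ≤ L (i, i') + L (i', i'') := fun i i' i'' =>
    le_of_tendsto_of_tendsto' (hL (i, i'')) ((hL (i, i')).add (hL (i', i'')))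
      fun k => edist_triangle _ _ _
  -- Each class of sequences of centers at bounded distance is represented by its least index.
  let S : Set ℕ := {i | ∀ i' < i, L (i', i) = ⊤}
  have hSsep : ∀ i ∈ S, ∀ i' ∈ S, i ≠ i' → L (i, i') = ⊤ := by
    intro i hi i' hi' hne
    rcases lt_or_gt_of_ne hne with h | h
    · exact hi' i h
    · rw [hLsymm]
      exact hi i' h
  have hSrep : ∀ i, ∃ i' ∈ S, L (i', i) < ⊤ := by
    classical
    intro i
    have hex : ∃ i', L (i', i) < ⊤ := ⟨i, by simp [hLself]⟩
    refine ⟨Nat.find hex, fun i' hi' => ?_, Nat.find_spec hex⟩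
    by_contra hne
    exact Nat.find_min hex hi' ((hLtri i' (Nat.find hex) i).trans_lt
      (ENNReal.add_lt_top.2 ⟨lt_top_iff_ne_top.2 hne, Nat.find_spec hex⟩))
  obtain ⟨R, hR, hRP⟩ := exists_tendsto_atTop_forall_of_eventually
    (P := fun m k => (∀ i ∈ Finset.range (m + 1), ∀ i' ∈ Finset.range (m + 1), i ∈ S → i' ∈ S →
        i ≠ i' → (2 * m : ℝ≥0∞) ≤ edist (c i (φ k)) (c i' (φ k))) ∧
      ∀ i ∈ Finset.range (m + 1), ∀ j : Fin p,
        (μ (φ k) j).map (fun y => y + -c i (φ k)) (Metric.closedBall 0 m) ≤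
          α (i, j) Set.univ + (m : ℝ≥0∞)⁻¹)
    (fun k => ⟨by simp, by simp⟩) (fun m => by
      refine Eventually.and ?_ ?_
      · simp only [eventually_all_finset, eventually_imp_distrib_left]
        intro i _ i' _ hi hi' hne
        have hlim := hL (i, i')
        rw [hSsep i hi i' hi' hne] at hlim
        have hlt : (2 * m : ℝ≥0∞) < ⊤ :=
          ENNReal.mul_lt_top ENNReal.ofNat_lt_top (ENNReal.natCast_lt_top m)
        filter_upwards [hlim.eventually (lt_mem_nhds hlt)] with k hk using hk.le
      · simp only [eventually_all_finset, eventually_all]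
        intro i _ j
        have hlt : limsup (fun k => (μ (φ k) j).map (fun y => y + -c i (φ k))
            (Metric.closedBall 0 m)) atTop < α (i, j) Set.univ + (m : ℝ≥0∞)⁻¹ := by
          refine ((hαcompact (i, j) _ (isCompact_closedBall 0 (m : ℝ))).trans
            (measure_mono (Set.subset_univ _))).trans_lt ?_
          exact ENNReal.lt_add_right (hαfin (i, j)).measure_univ_lt_top.ne
            (ENNReal.inv_ne_zero.2 (ENNReal.natCast_ne_top m))
        filter_upwards [eventually_lt_of_limsup_lt hlt] with k hk using hk.le)
  let A : S → ℕ → Set (EuclideanSpace ℝ (Fin d)) := fun i k =>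
    if (i : ℕ) ≤ R k then Metric.ball (c i (φ k)) (R k) else ∅
  have hAmeas : ∀ i k, MeasurableSet (A i k) := fun i k => by
    dsimp only [A]
    split_ifs
    exacts [Metric.isOpen_ball.measurableSet, MeasurableSet.empty]
  have hAdisj : ∀ k, Pairwise (Function.onFun Disjoint fun i => A i k) := by
    intro k i i' hne
    dsimp only [A, Function.onFun]
    split_ifs with hi hi'
    · refine Metric.ball_disjoint_ball ?_
      have := (hRP k).1 i (by simpa [Nat.lt_succ_iff] using hi) i'
        (by simpa [Nat.lt_succ_iff] using hi') i.2 i'.2 (fun h => hne (Subtype.ext h))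
      rw [edist_dist, ENNReal.le_ofReal_iff_toReal_le (by finiteness) dist_nonneg] at this
      simp at this
      linarith
    all_goals simp
  refine ⟨φ, hφ, S, inferInstance, fun i j => α (i, j), fun i k j => (μ (φ k) j).restrict (A i k),
    fun k j => (μ (φ k) j).restrict (⋃ i, A i k)ᶜ, fun i k => -c i (φ k), fun i j => hαfin (i, j),
    fun i k j => inferInstance, fun k j => inferInstance, ?_, ?_, ?_, ?_⟩
  · intro k j
    rw [← Measure.restrict_iUnion (hAdisj k) (fun i => hAmeas i k),
      Measure.restrict_add_restrict_compl (MeasurableSet.iUnion fun i => hAmeas i k)]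
  · intro i j f
    have hRi : ∀ᶠ k in atTop, (i : ℕ) ≤ R k := hR.eventually_ge_atTop i
    have hlim := tendsto_integral_restrict 0 hR (hαopen (i, j))
      (A := fun k => Metric.ball 0 (R k)) (Eventually.of_forall fun k => subset_rfl)
      (by
        filter_upwards [hRi] with k hk
        exact (measure_mono Metric.ball_subset_closedBall).trans
          ((hRP k).2 i (by simpa [Nat.lt_succ_iff] using hk) j)) f
    refine hlim.congr' ?_
    filter_upwards [hRi] with k hk
    rw [Measure.restrict_map (hshift _ _) Metric.isOpen_ball.measurableSet]
    congr 3
    ext y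
    simp [A, hk, dist_eq_norm, sub_eq_add_neg]
  · intro j r hr
    refine ENNReal.tendsto_nhds_zero.2 fun ε hε => ?_
    obtain ⟨m₁, hm₁⟩ := ENNReal.exists_inv_nat_lt hε.ne'
    obtain ⟨m₂, hm₂⟩ := exists_nat_ge r
    set m := max m₁ m₂ with hm
    have hmr : r ≤ m := hm₂.trans (by exact_mod_cast le_max_right m₁ m₂)
    have hmε : (m : ℝ≥0∞)⁻¹ ≤ ε :=
      (ENNReal.inv_le_inv.2 (by exact_mod_cast le_max_left m₁ m₂)).trans hm₁.le
    have hmpos : 0 < m := by exact_mod_cast hr.trans_le hmr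
    obtain ⟨N, hN⟩ := hc m hmpos
    have hnear : ∀ᶠ k in atTop, ∀ i ∈ Finset.range N, ∃ i' : S,
        Metric.ball (c i (φ k)) (3 * m) ⊆ A i' k := by
      rw [eventually_all_finset]
      intro i _
      obtain ⟨i', hi', hfin⟩ := hSrep i
      obtain ⟨T, hT⟩ := ENNReal.exists_nat_gt hfin.ne
      filter_upwards [(hL (i', i)).eventually (gt_mem_nhds hT), hR.eventually_ge_atTop i',
        hR.eventually_ge_atTop (3 * m + T)] with k hk hRi hRT
      refine ⟨⟨i', hi'⟩, ?_⟩
      have hdist : dist (c i (φ k)) (c i' (φ k)) < T := by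
        rw [edist_comm, edist_dist, ENNReal.ofReal_lt_iff_lt_toReal dist_nonneg (by simp)] at hk
        simpa using hk
      have hRT' : (3 * m + T : ℝ) ≤ R k := by exact_mod_cast hRT
      simp only [A, hRi, if_true]
      exact Metric.ball_subset_ball' (by linarith)
    filter_upwards [hnear] with k hk
    refine iSup_le fun y => ?_
    by_cases hy : (m : ℝ≥0∞)⁻¹ ≤ μ (φ k) j (Metric.ball y m)
    · obtain ⟨i, hi, hdist⟩ := hN (φ k) y (hy.trans (by
        rw [Measure.finsetSum_apply]
        exact Finset.single_le_sum (f := fun j => μ (φ k) j (Metric.ball y m))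
          (fun _ _ => zero_le) (Finset.mem_univ j)))
      obtain ⟨i', hi'⟩ := hk i (Finset.mem_range.2 hi)
      have hsub : Metric.ball y r ⊆ ⋃ i, A i k :=
        ((Metric.ball_subset_ball' (by linarith)).trans hi').trans
          (Set.subset_iUnion (fun i => A i k) i')
      rw [Measure.restrict_apply Metric.isOpen_ball.measurableSet,
        (Set.disjoint_compl_right_iff_subset.2 hsub).inter_eq, measure_empty]
      exact zero_le
    · exact ((Measure.restrict_apply_le _ _).trans
        (measure_mono (Metric.ball_subset_ball hmr))).trans ((not_le.1 hy).le.trans hmε)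
  · intro i i' hne
    have hlim := hL (i, i')
    rw [hSsep i i.2 i' i'.2 (fun h => hne (Subtype.ext h))] at hlim
    refine tendsto_atTop.2 fun b => ?_
    filter_upwards [hlim.eventually (lt_mem_nhds (ENNReal.ofReal_lt_top (r := b)))] with k hk
    rw [edist_dist] at hk
    rw [neg_sub_neg, ← dist_eq_norm, dist_comm]
    exact (ENNReal.ofReal_lt_ofReal_iff'.1 hk).1.le
end
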